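/- arXiv:2003.05500 — 2 statements merged into one kernel-verified Lean document; each statement's English description precedes it below -/
import Mathlib

section
/- Let X be a stationary stochastic process over a finite alphabet A with stationary measure μ on A^ℕ, and let f be the run-length encoder. If hypothesis (A) holds, the process is α-mixing with exponentially decaying mixing coefficients, and the Rényi entropy of order 2 of the pushforward f_*μ exists (i.e. the lower and upper Rényi entropies coincide) and is strictly positive, then for μ⊗μ-almost every pair of sequences (x, y), lim_{n→∞} M^RLE_n(x,y)/log n = 2/H₂(f_*μ). -/
open MeasureTheory Filter Topology

section RLEDefs

variable {A : Type*}

/-- The starting position of the run following the run that starts at position `i`: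
the least index `> i` where the value of `x` changes (with the junk convention `i + 1`
if the sequence is constant from position `i` on). -/
noncomputable def nextChange (x : ℕ → A) (i : ℕ) : ℕ := by
  classical
  exact if h : ∃ j, x (i + j + 1) ≠ x i then i + Nat.find h + 1 else i + 1

/-- Starting position of the `n`-th maximal run of the sequence `x`. -/
noncomputable def runStart (x : ℕ → A) : ℕ → ℕ
  | 0 => 0
  | n + 1 => nextChange x (runStart x n)

/-- The run-length encoder `f : A^ℕ → (A × ℕ)^ℕ`: the `n`-th symbol of `f x` is the pair
(value of the `n`-th maximal run of `x`, length of that run). -/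
noncomputable def rle (x : ℕ → A) (n : ℕ) : A × ℕ :=
  (x (runStart x n), runStart x (n + 1) - runStart x n)

/-- `M_n(u,v)`: the length of the longest common substring of `u` and `v`
occurring within their first `n` symbols, i.e.
`max {k : u_i^{i+k-1} = v_j^{j+k-1} for some 0 ≤ i,j ≤ n-k}`. -/
noncomputable def matchLen {C : Type*} (u v : ℕ → C) (n : ℕ) : ℕ :=
  sSup {k | ∃ i j, i + k ≤ n ∧ j + k ≤ n ∧ ∀ m < k, u (i + m) = v (j + m)}

/-- `M^RLE_n(x,y) = M_n(f x, f y)`. -/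
noncomputable def MRLE (x y : ℕ → A) (n : ℕ) : ℕ := matchLen (rle x) (rle y) n

/-- `M̃_n(x,y) = max {k : f(σ^i x)_1^k = f(σ^j y)_1^k for some 0 ≤ i,j ≤ n-k}`. -/
noncomputable def Mtilde (x y : ℕ → A) (n : ℕ) : ℕ :=
  sSup {k | ∃ i j, i + k ≤ n ∧ j + k ≤ n ∧
    ∀ m < k, rle (fun t => x (t + i)) m = rle (fun t => y (t + j)) m}

/-- The number of maximal runs in the first `n` symbols of `x`, i.e. `|f(x_1^n)|`. -/
noncomputable def runCount (x : ℕ → A) (n : ℕ) : ℕ := by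
  classical
  exact ((Finset.range n).filter fun i => i = 0 ∨ x i ≠ x (i - 1)).card

/-- The left shift `σ` on sequences. -/
def shift (x : ℕ → A) : ℕ → A := fun n => x (n + 1)

variable [MeasurableSpace A]

/-- `Σ_{ω ∈ B^n} (f_*μ)(ω)²`: the sum, over all cylinders `ω` of length `n` in
`B^ℕ = (A × ℕ)^ℕ`, of the squared measure of `f⁻¹ω` (where `f` is the run-length
encoder), i.e. of the squared pushforward measure of the cylinder. -/
noncomputable def pushCylSum (μ : Measure (ℕ → A)) (n : ℕ) : ℝ :=
  ∑' ω : Fin n → A × ℕ, ((μ {x | ∀ i : Fin n, rle x i = ω i}).toReal) ^ 2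

/-- Lower Rényi entropy of order 2 of the pushforward measure `f_*μ`:
`H̲₂(f_*μ) = - liminf_n (1/n) log Σ_ω (f_*μ)(ω)²`. -/
noncomputable def H2lower (μ : Measure (ℕ → A)) : ℝ :=
  -liminf (fun n : ℕ => Real.log (pushCylSum μ n) / n) atTop

/-- Upper Rényi entropy of order 2 of the pushforward measure `f_*μ`:
`H̄₂(f_*μ) = - limsup_n (1/n) log Σ_ω (f_*μ)(ω)²`. -/
noncomputable def H2upper (μ : Measure (ℕ → A)) : ℝ :=
  -limsup (fun n : ℕ => Real.log (pushCylSum μ n) / n) atTop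

/-- Hypothesis (A): there are `c > 0`, `h > 0` with `μ(a…a) ≤ c e^{-hn}` for every
constant cylinder `a…a` of length `n`. -/
def HypA (μ : Measure (ℕ → A)) (c h : ℝ) : Prop :=
  0 < c ∧ 0 < h ∧
    ∀ (n : ℕ) (a : A), μ {x | ∀ i < n, x i = a} ≤ ENNReal.ofReal (c * Real.exp (-h * n))

/-- The σ-algebra `F_0^n` generated by the coordinates `X_0, …, X_n`. -/
def cylAlgLE (A : Type*) [MeasurableSpace A] (n : ℕ) : MeasurableSpace (ℕ → A) :=
  MeasurableSpace.comap (fun x (i : Fin (n + 1)) => x i) inferInstance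

/-- The σ-algebra `F_m^∞` generated by the coordinates `X_m, X_{m+1}, …`. -/
def cylAlgGE (A : Type*) [MeasurableSpace A] (m : ℕ) : MeasurableSpace (ℕ → A) :=
  MeasurableSpace.comap (fun x (i : ℕ) => x (m + i)) inferInstance

/-- α-mixing with rate function `a`: for all `n, g` and all `S ∈ F_0^n`, `T ∈ F_{n+g}^∞`,
`|μ(S ∩ T) - μ(S)μ(T)| ≤ a(g)`. -/
def AlphaMixingBound (μ : Measure (ℕ → A)) (a : ℕ → ℝ) : Prop :=
  ∀ (n g : ℕ) (S T : Set (ℕ → A)),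
    MeasurableSet[cylAlgLE A n] S → MeasurableSet[cylAlgGE A (n + g)] T →
    |(μ (S ∩ T)).toReal - (μ S).toReal * (μ T).toReal| ≤ a g

/-- α-mixing with exponential decay. -/
def AlphaMixingExp (μ : Measure (ℕ → A)) : Prop :=
  ∃ C θ : ℝ, 0 < C ∧ 0 < θ ∧ AlphaMixingBound μ fun g => C * Real.exp (-θ * g)

/-- ψ-mixing with polynomial rate `ψ(g) = g^{-a}`: for all `n` and `g ≥ 1` and all
`S ∈ F_0^n`, `T ∈ F_{n+g}^∞`, `|μ(S ∩ T) - μ(S)μ(T)| ≤ g^{-a} μ(S) μ(T)`. -/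
def PsiMixingPoly (μ : Measure (ℕ → A)) (a : ℝ) : Prop :=
  ∀ (n g : ℕ), 1 ≤ g → ∀ (S T : Set (ℕ → A)),
    MeasurableSet[cylAlgLE A n] S → MeasurableSet[cylAlgGE A (n + g)] T →
    |(μ (S ∩ T)).toReal - (μ S).toReal * (μ T).toReal| ≤
      (g : ℝ) ^ (-a) * (μ S).toReal * (μ T).toReal

/-- `S_n = Σ_{0 ≤ i,j ≤ n-1} 1_{A_{i,j}}` with `A_{i,j} = {f(σ^i X)_1^k = f(σ^j Y)_1^k}`,
seen as a random variable on the product space (X = first coordinate, Y = second). -/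
noncomputable def Sn (k n : ℕ) (p : (ℕ → A) × (ℕ → A)) : ℝ := by
  classical
  exact ∑ i ∈ Finset.range n, ∑ j ∈ Finset.range n,
    if ∀ m < k, rle (fun t => p.1 (t + i)) m = rle (fun t => p.2 (t + j)) m then (1 : ℝ) else 0

end RLEDefs

section Det
variable {A : Type*}

lemma nextChange_eq {x : ℕ → A} {i j : ℕ} (hij : i < j) (hne : x j ≠ x i)
    (hc : ∀ t, i ≤ t → t < j → x t = x i) : nextChange x i = j := by
  classical
  have h : ∃ l, x (i + l + 1) ≠ x i :=
    ⟨j - i - 1, by rwa [show i + (j - i - 1) + 1 = j by omega]⟩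
  unfold nextChange
  rw [dif_pos h]
  have h1 := Nat.find_spec h
  have h2 : Nat.find h ≤ j - i - 1 :=
    Nat.find_min' h (by rwa [show i + (j - i - 1) + 1 = j by omega])
  by_contra hcon
  exact h1 (hc _ (by omega) (by omega))

lemma nextChange_const {x : ℕ → A} {i : ℕ} (hc : ∀ t, i ≤ t → x t = x i) :
    nextChange x i = i + 1 := by
  classical
  unfold nextChange
  rw [dif_neg]
  rintro ⟨j, hj⟩
  exact hj (hc _ (by omega))

lemma nextChange_spec (x : ℕ → A) (i : ℕ) :
    (i < nextChange x i ∧ x (nextChange x i) ≠ x i ∧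
      ∀ t, i ≤ t → t < nextChange x i → x t = x i) ∨
    ((∀ t, i ≤ t → x t = x i) ∧ nextChange x i = i + 1) := by
  classical
  by_cases h : ∃ l, x (i + l + 1) ≠ x i
  · left
    have h1 := Nat.find_spec h
    have h3 : nextChange x i = i + Nat.find h + 1 := by
      unfold nextChange; rw [dif_pos h]
    rw [h3]
    refine ⟨by omega, h1, fun t ht1 ht2 => ?_⟩
    rcases Nat.eq_or_lt_of_le ht1 with h4 | h4
    · rw [h4]
    · have := Nat.find_min h (m := t - i - 1) (by omega)
      rw [show i + (t - i - 1) + 1 = t by omega] at this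
      simpa using this
  · right
    push Not at h
    have : ∀ t, i ≤ t → x t = x i := by
      intro t ht
      rcases Nat.eq_or_lt_of_le ht with h4 | h4
      · rw [h4]
      · have := h (t - i - 1)
        rwa [show i + (t - i - 1) + 1 = t by omega] at this
    exact ⟨this, nextChange_const this⟩

lemma lt_nextChange (x : ℕ → A) (i : ℕ) : i < nextChange x i := by
  rcases nextChange_spec x i with h | h
  · exact h.1
  · omega

lemma nextChange_shift (x : ℕ → A) (i t : ℕ) :
    nextChange (fun s => x (s + i)) t + i = nextChange x (t + i) := by
  rcases nextChange_spec (fun s => x (s + i)) t with ⟨h1, h2, h3⟩ | ⟨h1, h2⟩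
  · refine (nextChange_eq (by omega) h2 ?_).symm
    intro s hs1 hs2
    have := h3 (s - i) (by omega) (by omega)
    simpa [show s - i + i = s by omega] using this
  · rw [h2, nextChange_const]
    · omega
    · intro s hs
      have := h1 (s - i) (by omega)
      simpa [show s - i + i = s by omega] using this

lemma runStart_lt_succ (x : ℕ → A) (n : ℕ) : runStart x n < runStart x (n + 1) :=
  lt_nextChange x _

lemma runStart_strictMono (x : ℕ → A) : StrictMono (runStart x) :=
  strictMono_nat_of_lt_succ (runStart_lt_succ x)

lemma runStart_shift {x : ℕ → A} {i m₀ r₀ : ℕ}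
    (h : runStart (fun t => x (t + i)) m₀ + i = runStart x r₀) (m : ℕ) :
    runStart (fun t => x (t + i)) (m₀ + m) + i = runStart x (r₀ + m) := by
  induction m with
  | zero => exact h
  | succ m ih =>
    show nextChange _ (runStart _ (m₀ + m)) + i = nextChange x (runStart x (r₀ + m))
    rw [nextChange_shift, ih]

lemma rle_shift {x : ℕ → A} {i m₀ r₀ : ℕ}
    (h : runStart (fun t => x (t + i)) m₀ + i = runStart x r₀) (m : ℕ) :
    rle (fun t => x (t + i)) (m₀ + m) = rle x (r₀ + m) := by
  have h1 := runStart_shift h m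
  have h2 := runStart_shift h (m + 1)
  unfold rle
  rw [show m₀ + m + 1 = m₀ + (m + 1) by ring, show r₀ + m + 1 = r₀ + (m + 1) by ring, ← h1, ← h2]
  simp only [Prod.mk.injEq, true_and]
  omega

/-- the run start after an arbitrary position -/
lemma exists_run (x : ℕ → A) (i : ℕ) :
    ∃ r, r ≤ i ∧ runStart (fun t => x (t + i)) 1 + i = runStart x (r + 1) := by
  obtain ⟨r, hr1, hr2⟩ : ∃ r, runStart x r ≤ i ∧ i < runStart x (r + 1) := by
    by_contra hcon
    push Not at hcon
    have : ∀ r, runStart x r ≤ i := by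
      intro r
      induction r with
      | zero => exact Nat.zero_le _
      | succ r ih => exact hcon r ih
    have h1 := this (i + 1)
    have h2 := (runStart_strictMono x).le_apply (x := i + 1)
    omega
  refine ⟨r, ((runStart_strictMono x).le_apply (x := r)).trans hr1, ?_⟩
  show nextChange _ 0 + i = nextChange x (runStart x r)
  rw [nextChange_shift, Nat.zero_add]
  change i < nextChange x (runStart x r) at hr2
  rcases nextChange_spec x (runStart x r) with ⟨h1, h2, h3⟩ | ⟨h1, h2⟩
  · refine nextChange_eq hr2 ?_ ?_
    · rw [h3 i hr1 hr2]; exact h2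
    · intro t ht1 ht2
      rw [h3 i hr1 hr2]
      exact h3 t (hr1.trans ht1) ht2
  · have : i = runStart x r := by omega
    rw [this]

/-- match of the first `k` run-length symbols after positions `i`, `j` -/
def RMatch (k : ℕ) (x y : ℕ → A) : Prop := ∀ m < k, rle x m = rle y m

lemma matchSet_bdd {C : Type*} (u v : ℕ → C) (n : ℕ) :
    BddAbove {k | ∃ i j, i + k ≤ n ∧ j + k ≤ n ∧ ∀ m < k, u (i + m) = v (j + m)} :=
  ⟨n, by rintro k ⟨i, j, h, -⟩; omega⟩

lemma matchLen_mono {C : Type*} (u v : ℕ → C) : Monotone (matchLen u v) := by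
  intro n n' hn
  apply csSup_le_csSup (matchSet_bdd u v n')
  · exact ⟨0, 0, 0, by simp⟩
  · rintro k ⟨i, j, h1, h2, h3⟩
    exact ⟨i, j, by omega, by omega, h3⟩

lemma MRLE_mono (x y : ℕ → A) : Monotone (MRLE x y) := matchLen_mono _ _

lemma le_MRLE {x y : ℕ → A} {i j k N : ℕ} (hi : i + k ≤ N) (hj : j + k ≤ N)
    (h : RMatch k (fun t => x (t + i)) (fun t => y (t + j))) : k ≤ MRLE x y N + 1 := by
  rcases Nat.eq_zero_or_pos k with hk | hk
  · omega
  obtain ⟨r, hr, hr'⟩ := exists_run x i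
  obtain ⟨s, hs, hs'⟩ := exists_run y j
  have : k - 1 ≤ MRLE x y N := by
    apply le_csSup (matchSet_bdd _ _ N)
    refine ⟨r + 1, s + 1, by omega, by omega, fun m hm => ?_⟩
    rw [← rle_shift hr' m, ← rle_shift hs' m]
    exact h _ (by omega)
  omega

/-- long constant block of length `M` starting at or before `L` -/
def Bad (M L : ℕ) (x : ℕ → A) : Prop := ∃ i ≤ L, ∀ t < M, x (i + t) = x i

lemma nextChange_le {x : ℕ → A} {M L i : ℕ} (hb : ¬ Bad M L x) (hi : i ≤ L) :
    nextChange x i ≤ i + M ∧ i < nextChange x i ∧ x (nextChange x i) ≠ x i ∧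
      ∀ t, i ≤ t → t < nextChange x i → x t = x i := by
  unfold Bad at hb
  push Not at hb
  obtain ⟨t, ht, hne⟩ := hb i hi
  rcases nextChange_spec x i with h | h
  · refine ⟨?_, h⟩
    by_contra hcon
    exact hne (h.2.2 _ (by omega) (by omega))
  · exact absurd (h.1 _ (by omega)) hne

lemma runStart_le {x : ℕ → A} {M L m : ℕ} (hb : ¬ Bad M L x) (hm : m * M ≤ L) :
    runStart x m ≤ m * M := by
  induction m with
  | zero => exact Nat.zero_le _
  | succ m ih =>
    have h1 : m * M + M ≤ L := by rw [← Nat.succ_mul]; exact hm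
    have h2 := ih (by omega)
    have := (nextChange_le hb (show runStart x m ≤ L by omega)).1
    show nextChange x (runStart x m) ≤ _
    rw [Nat.succ_mul]; omega

lemma runStart_congr {x y : ℕ → A} {M L m : ℕ} (hb : ¬ Bad M L x) (hm : m * M ≤ L)
    (hxy : ∀ t ≤ L, x t = y t) : runStart y m = runStart x m := by
  induction m with
  | zero => rfl
  | succ m ih =>
    have h1 : m * M + M ≤ L := by rw [← Nat.succ_mul]; exact hm
    have h2 := ih (by omega)
    have h3 := runStart_le hb (show m * M ≤ L by omega)
    obtain ⟨h4, h5, h6, h7⟩ := nextChange_le hb (show runStart x m ≤ L by omega)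
    show nextChange y (runStart y m) = nextChange x (runStart x m)
    rw [h2]
    apply nextChange_eq h5
    · rw [← hxy _ (by omega), ← hxy _ (by omega)]; exact h6
    · intro t ht1 ht2
      rw [← hxy _ (by omega), ← hxy _ (by omega)]; exact h7 t ht1 ht2

lemma rle_congr {x y : ℕ → A} {M L k : ℕ} (hb : ¬ Bad M L x) (hk : k * M ≤ L)
    (hxy : ∀ t ≤ L, x t = y t) {m : ℕ} (hm : m < k) : rle y m = rle x m := by
  have h1 : (m + 1) * M ≤ L := (Nat.mul_le_mul_right M hm).trans hk
  have h0 : m * M ≤ L := (Nat.mul_le_mul_right M hm.le).trans hk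
  unfold rle
  rw [runStart_congr hb h1 hxy, runStart_congr hb h0 hxy,
    ← hxy _ ((runStart_le hb h0).trans h0)]

/-- if the match length is at least k then matching positions exist -/
lemma exists_of_le_MRLE {x y : ℕ → A} {M N k : ℕ} (hk : k ≤ MRLE x y N)
    (hx : ¬ Bad M (N * M) x) (hy : ¬ Bad M (N * M) y) :
    ∃ i ≤ N * M, ∃ j ≤ N * M, RMatch k (fun t => x (t + i)) (fun t => y (t + j)) := by
  have hmem : MRLE x y N ∈ {k | ∃ i j, i + k ≤ N ∧ j + k ≤ N ∧
      ∀ m < k, rle x (i + m) = rle y (j + m)} :=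
    Nat.sSup_mem ⟨0, 0, 0, by simp⟩ (matchSet_bdd _ _ N)
  obtain ⟨i, j, hi, hj, h⟩ := hmem
  have hi' : i * M ≤ N * M := Nat.mul_le_mul_right M (by omega)
  have hj' : j * M ≤ N * M := Nat.mul_le_mul_right M (by omega)
  refine ⟨runStart x i, (runStart_le hx hi').trans hi', runStart y j,
    (runStart_le hy hj').trans hj', fun m hm => ?_⟩
  have e1 := rle_shift (x := x) (i := runStart x i) (m₀ := 0) (r₀ := i)
    (by show 0 + _ = _; simp) m
  have e2 := rle_shift (x := y) (i := runStart y j) (m₀ := 0) (r₀ := j)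
    (by show 0 + _ = _; simp) m
  rw [Nat.zero_add] at e1 e2
  rw [e1, e2]
  exact h m (by omega)

lemma Bad.shift {x : ℕ → A} {M L i L' : ℕ} (h : Bad M L (fun t => x (t + i)))
    (hL : i + L ≤ L') : Bad M L' x := by
  obtain ⟨s, hs, h⟩ := h
  exact ⟨s + i, by omega, fun t ht => by
    have := h t ht
    simp only at this
    rw [← this]; congr 1; omega⟩

end Det


lemma tendsto_of_interp (M : ℕ → ℕ) (hM : Monotone M) (l : ℝ) (hl : 0 < l)
    (hup : ∀ q : ℚ, 0 < (q : ℝ) → (q : ℝ) < l → ∀ᶠ k : ℕ in atTop, M ⌊Real.exp (k * q)⌋₊ < k)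
    (hlo : ∀ q : ℚ, l < (q : ℝ) → ∀ᶠ k : ℕ in atTop, k ≤ M ⌊Real.exp (k * q)⌋₊ + 1) :
    Tendsto (fun n : ℕ => (M n : ℝ) / Real.log n) atTop (𝓝 (1 / l)) := by
  have hlog : Tendsto (fun n : ℕ => Real.log n) atTop atTop :=
    Real.tendsto_log_atTop.comp tendsto_natCast_atTop_atTop
  have hpos : ∀ᶠ n : ℕ in atTop, 1 < Real.log n := hlog.eventually_gt_atTop 1
  -- upper
  have hU : ∀ q : ℚ, 0 < (q : ℝ) → (q : ℝ) < l →
      ∀ᶠ n : ℕ in atTop, (M n : ℝ) / Real.log n ≤ 1 / q + 1 / Real.log n := by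
    intro q hq hql
    have h1 : Tendsto (fun n : ℕ => ⌈Real.log n / q⌉₊) atTop atTop :=
      tendsto_nat_ceil_atTop.comp (hlog.atTop_div_const hq)
    filter_upwards [h1.eventually (hup q hq hql), hpos, eventually_gt_atTop 0] with n h2 h3 hn
    have h4 : n ≤ ⌊Real.exp ((⌈Real.log n / q⌉₊ : ℝ) * q)⌋₊ := by
      apply Nat.le_floor
      rw [← Real.log_le_iff_le_exp (by exact_mod_cast hn)]
      have := Nat.le_ceil (Real.log n / q)
      rwa [div_le_iff₀ hq] at this
    have h5 : (M n : ℝ) + 1 ≤ ⌈Real.log n / q⌉₊ := by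
      exact_mod_cast lt_of_le_of_lt (hM h4) h2
    have h6 : (⌈Real.log n / q⌉₊ : ℝ) < Real.log n / q + 1 :=
      Nat.ceil_lt_add_one (by positivity)
    have h7 : (M n : ℝ) ≤ Real.log n / q + 1 := by linarith
    calc (M n : ℝ) / Real.log n ≤ (Real.log n / q + 1) / Real.log n := by gcongr
      _ = _ := by field_simp
  have hLo : ∀ q : ℚ, l < (q : ℝ) →
      ∀ᶠ n : ℕ in atTop, 1 / (q : ℝ) - 2 / Real.log n ≤ (M n : ℝ) / Real.log n := by
    intro q hql
    have hq : (0 : ℝ) < q := hl.trans hql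
    have h1 : Tendsto (fun n : ℕ => ⌊Real.log n / q⌋₊) atTop atTop :=
      tendsto_nat_floor_atTop.comp (hlog.atTop_div_const hq)
    filter_upwards [h1.eventually (hlo q hql), hpos, eventually_gt_atTop 0] with n h2 h3 hn
    have h4 : ⌊Real.exp ((⌊Real.log n / q⌋₊ : ℝ) * q)⌋₊ ≤ n := by
      apply Nat.floor_le_of_le
      rw [← Real.le_log_iff_exp_le (by exact_mod_cast hn)]
      have := Nat.floor_le (show 0 ≤ Real.log n / q by positivity)
      rwa [le_div_iff₀ hq] at this
    have h5 : (⌊Real.log n / q⌋₊ : ℝ) ≤ M n + 1 := by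
      exact_mod_cast h2.trans (Nat.add_le_add_right (hM h4) 1)
    have h6 := Nat.lt_floor_add_one (Real.log n / q)
    have h7 : Real.log n / q - 2 ≤ (M n : ℝ) := by linarith
    calc _ = (Real.log n / q - 2) / Real.log n := by field_simp
      _ ≤ _ := by gcongr
  have hinv : Tendsto (fun n : ℕ => (Real.log n)⁻¹) atTop (𝓝 0) := hlog.inv_tendsto_atTop
  have hcont : ContinuousAt (fun r : ℝ => 1 / r) l := by
    apply ContinuousAt.div continuousAt_const continuousAt_id hl.ne'
  rw [tendsto_order]
  constructor
  · intro b hb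
    have : ∀ᶠ r in 𝓝 l, b < 1 / r := hcont.eventually (lt_mem_nhds hb)
    obtain ⟨e, he, hball⟩ := Metric.eventually_nhds_iff.1 this
    obtain ⟨q, hq1, hq2⟩ := exists_rat_btwn (show l < l + e by linarith)
    have hbq : b < 1 / (q : ℝ) := hball (by rw [Real.dist_eq, abs_lt]; constructor <;> linarith)
    have h3 : Tendsto (fun n : ℕ => 1 / (q : ℝ) - 2 / Real.log n) atTop (𝓝 (1 / (q : ℝ) - 2 * 0)) :=
      (hinv.const_mul 2).const_sub _
    rw [mul_zero, sub_zero] at h3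
    filter_upwards [hLo q hq1, h3.eventually (lt_mem_nhds hbq)] with n h4 h5
    linarith
  · intro b hb
    have : ∀ᶠ r in 𝓝 l, 1 / r < b := hcont.eventually (gt_mem_nhds hb)
    obtain ⟨e, he, hball⟩ := Metric.eventually_nhds_iff.1 this
    obtain ⟨q, hq1, hq2⟩ := exists_rat_btwn (show max 0 (l - e) < l by
      rw [max_lt_iff]; constructor <;> linarith)
    rw [max_lt_iff] at hq1
    have hbq : 1 / (q : ℝ) < b := hball (by rw [Real.dist_eq, abs_lt]; constructor <;> linarith)
    have h3 : Tendsto (fun n : ℕ => 1 / (q : ℝ) + 1 / Real.log n) atTop (𝓝 (1 / (q : ℝ) + 1 * 0)) :=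
      (hinv.const_mul 1).const_add _
    rw [mul_zero, add_zero] at h3
    filter_upwards [hU q hq1.1 hq2, h3.eventually (gt_mem_nhds hbq)] with n h4 h5
    linarith

lemma ae_eventually_of_summable {Ω : Type*} [MeasurableSpace Ω] (P : Measure Ω)
    [IsProbabilityMeasure P] (s : ℕ → Set Ω) (b : ℕ → ℝ) (hb : Summable b)
    (h : ∀ᶠ k in atTop, P.real (s k) ≤ b k) : ∀ᵐ x ∂P, ∀ᶠ k in atTop, x ∉ s k := by
  obtain ⟨K, hK⟩ := eventually_atTop.1 h
  have h1 : ∀ᵐ x ∂P, ∀ᶠ k in atTop, x ∉ s (k + K) := by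
    apply ae_eventually_notMem
    have hb' : Summable fun k => b (k + K) := (summable_nat_add_iff K).2 hb
    have h3 : ∀ k, P (s (k + K)) ≤ ENNReal.ofReal (b (k + K)) := by
      intro k
      rw [← ofReal_measureReal]
      exact ENNReal.ofReal_le_ofReal (hK _ (by omega))
    refine ne_top_of_le_ne_top ?_ (ENNReal.tsum_le_tsum h3)
    exact hb'.tsum_ofReal_ne_top
  filter_upwards [h1] with x hx
  obtain ⟨k0, hk0⟩ := eventually_atTop.1 hx
  refine eventually_atTop.2 ⟨k0 + K, fun k hk => ?_⟩
  have := hk0 (k - K) (by omega)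
  rwa [Nat.sub_add_cancel (by omega)] at this

/-- abstract second-moment algebra -/
lemma second_moment_alg {W : Type*} [Fintype W] [DecidableEq W] (q : W → ℝ) (Cc : W → W → ℝ)
    (n α p : ℝ) (hn : 1 ≤ n) (hα : 0 ≤ α) (hq : ∀ w, 0 ≤ q w) (hq1 : ∑ w, q w = 1)
    (hp : p = ∑ w, q w ^ 2) (hC0 : ∀ w w', 0 ≤ Cc w w')
    (hC1 : ∑ w, ∑ w', Cc w w' = n ^ 2)
    (hC : ∀ w w', Cc w w' ≤ n ^ 2 * (q w * q w') + n ^ 2 * α + if w = w' then n * q w else 0) :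
    ∑ w, ∑ w', Cc w w' ^ 2 ≤
      n ^ 4 * p ^ 2 + 2 * n ^ 3 * (p * √p) + n ^ 2 * p + 3 * n ^ 4 * α := by
  have hq3 : ∑ w, q w ^ 3 ≤ p * √p := by
    have : ∀ w, q w ≤ √p := by
      intro w
      apply Real.le_sqrt_of_sq_le
      rw [hp]
      exact Finset.single_le_sum (f := fun w => q w ^ 2) (fun i _ => sq_nonneg _) (Finset.mem_univ w)
    rw [hp, Finset.sum_mul]
    apply Finset.sum_le_sum
    intro w _
    rw [pow_succ]
    exact mul_le_mul_of_nonneg_left (by rw [← hp]; exact this w) (sq_nonneg _)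
  have hqq : ∑ w, ∑ w', q w * q w' = 1 := by
    rw [← Finset.sum_mul_sum, hq1, mul_one]
  have hpp : ∑ w, ∑ w', (q w * q w') ^ 2 = p ^ 2 := by
    rw [hp, sq, Finset.sum_mul_sum]
    simp_rw [mul_pow]
  have hT1 : ∑ w, ∑ w', (q w * q w') * Cc w w' ≤ n ^ 2 * p ^ 2 + n ^ 2 * α + n * ∑ w, q w ^ 3 := by
    calc ∑ w, ∑ w', (q w * q w') * Cc w w'
        ≤ ∑ w, ∑ w', (n ^ 2 * (q w * q w') ^ 2 + n ^ 2 * α * (q w * q w') +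
            if w = w' then n * q w ^ 3 else 0) := by
          apply Finset.sum_le_sum; intro w _; apply Finset.sum_le_sum; intro w' _
          refine (mul_le_mul_of_nonneg_left (hC w w') (mul_nonneg (hq w) (hq w'))).trans ?_
          split_ifs with hw
          · subst hw; apply le_of_eq; ring
          · apply le_of_eq; ring
      _ = n ^ 2 * ∑ w, ∑ w', (q w * q w') ^ 2 + n ^ 2 * α * ∑ w, ∑ w', q w * q w' +
            ∑ w, ∑ w', if w = w' then n * q w ^ 3 else 0 := by
          simp only [Finset.sum_add_distrib, Finset.mul_sum]
      _ = _ := by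
          rw [hqq, hpp]
          simp [Finset.mul_sum]
  have hT2 : ∑ w, q w * Cc w w ≤ n ^ 2 * ∑ w, q w ^ 3 + n ^ 2 * α + n * p := by
    calc ∑ w, q w * Cc w w ≤ ∑ w, (n ^ 2 * q w ^ 3 + n ^ 2 * α * q w + n * q w ^ 2) := by
          apply Finset.sum_le_sum; intro w _
          refine (mul_le_mul_of_nonneg_left (hC w w) (hq w)).trans ?_
          rw [if_pos rfl]; apply le_of_eq; ring
      _ = _ := by
          simp_rw [Finset.sum_add_distrib, ← Finset.mul_sum, hq1, ← hp]; ring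
  have hmain : ∑ w, ∑ w', Cc w w' ^ 2 ≤
      n ^ 2 * ∑ w, ∑ w', (q w * q w') * Cc w w' + n ^ 2 * α * n ^ 2 + n * ∑ w, q w * Cc w w := by
    calc ∑ w, ∑ w', Cc w w' ^ 2
        ≤ ∑ w, ∑ w', (n ^ 2 * ((q w * q w') * Cc w w') + n ^ 2 * α * Cc w w' +
            if w = w' then n * (q w * Cc w w) else 0) := by
          apply Finset.sum_le_sum; intro w _; apply Finset.sum_le_sum; intro w' _
          rw [sq]
          refine (mul_le_mul_of_nonneg_right (hC w w') (hC0 w w')).trans ?_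
          split_ifs with hw
          · subst hw; apply le_of_eq; ring
          · apply le_of_eq; ring
      _ = n ^ 2 * ∑ w, ∑ w', (q w * q w') * Cc w w' + n ^ 2 * α * ∑ w, ∑ w', Cc w w' +
            ∑ w, ∑ w', if w = w' then n * (q w * Cc w w) else 0 := by
          simp only [Finset.sum_add_distrib, Finset.mul_sum]
      _ = _ := by
          rw [hC1]
          simp [Finset.mul_sum]
  have hn0 : 0 ≤ n := by linarith
  have e1 := mul_le_mul_of_nonneg_left hT1 (pow_nonneg hn0 2)
  have e2 := mul_le_mul_of_nonneg_left hT2 hn0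
  have e3 := mul_le_mul_of_nonneg_left hq3 (show 0 ≤ 2 * n ^ 3 by positivity)
  have e4 : n ^ 3 * α ≤ n ^ 4 * α := by gcongr; norm_num
  nlinarith [e1, e2, e3, e4, hmain]


lemma second_moment {Ω W : Type*} [MeasurableSpace Ω] (P : Measure Ω) [IsProbabilityMeasure P]
    [Fintype W] [DecidableEq W] [MeasurableSpace W] [MeasurableSingletonClass W]
    (n : ℕ) (hn : 1 ≤ n) (X : ℕ → Ω → W) (hX : ∀ i, Measurable (X i)) (q : W → ℝ)
    (hq : ∀ i w, P.real {x | X i x = w} = q w) (α : ℝ) (hα : 0 ≤ α)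
    (hmix : ∀ i i', i ≠ i' → ∀ w w', P.real ({x | X i x = w} ∩ {x | X i' x = w'}) ≤ q w * q w' + α)
    (p : ℝ) (hp : p = ∑ w, q w ^ 2) :
    (P.prod P).real {z | ∀ i < n, ∀ j < n, X i z.1 ≠ X j z.2} * ((n : ℝ) ^ 4 * p ^ 2) ≤
      2 * (n : ℝ) ^ 3 * (p * √p) + (n : ℝ) ^ 2 * p + 3 * (n : ℝ) ^ 4 * α := by
  classical
  have hmeas : ∀ i w, MeasurableSet {x | X i x = w} := fun i w => hX i (measurableSet_singleton w)
  set N : W → Ω → ℝ := fun w x => ∑ i ∈ Finset.range n, if X i x = w then (1 : ℝ) else 0 with hN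
  have hNm : ∀ w, Measurable (N w) := fun w =>
    Finset.measurable_sum _ fun i _ => Measurable.ite (hmeas i w) measurable_const measurable_const
  have hN0 : ∀ w x, 0 ≤ N w x := fun w x =>
    Finset.sum_nonneg fun i _ => by split_ifs <;> norm_num
  have hNsum : ∀ x, ∑ w, N w x = n := by
    intro x
    simp only [hN]
    rw [Finset.sum_comm]
    simp
  have hNn : ∀ w x, N w x ≤ n := fun w x => by
    rw [← hNsum x]
    exact Finset.single_le_sum (f := fun w => N w x) (fun i _ => hN0 i x) (Finset.mem_univ w)
  have hNi : ∀ w, Integrable (N w) P := fun w =>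
    Integrable.of_bound (hNm w).aestronglyMeasurable n
      (Eventually.of_forall fun x => by rw [Real.norm_of_nonneg (hN0 w x)]; exact hNn w x)
  have hNNi : ∀ w w', Integrable (fun x => N w x * N w' x) P := fun w w' =>
    Integrable.of_bound ((hNm w).mul (hNm w')).aestronglyMeasurable (n * n)
      (Eventually.of_forall fun x => by
        rw [Real.norm_of_nonneg (mul_nonneg (hN0 w x) (hN0 w' x))]
        exact mul_le_mul (hNn w x) (hNn w' x) (hN0 w' x) (Nat.cast_nonneg n))
  have hind : ∀ (r : Ω → Prop) [DecidablePred r], MeasurableSet {x | r x} →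
      ∫ x, (if r x then (1 : ℝ) else 0) ∂P = P.real {x | r x} := by
    intro r _ hs
    rw [← integral_indicator_one (μ := P) hs]
    congr 1
    ext x
    by_cases hx : r x <;> simp [Set.indicator, hx]
  have hindi : ∀ (r : Ω → Prop) [DecidablePred r], MeasurableSet {x | r x} →
      Integrable (fun x => if r x then (1 : ℝ) else 0) P := by
    intro r _ hs
    refine ((integrable_const (1 : ℝ)).indicator hs).congr (Eventually.of_forall fun x => ?_)
    by_cases hx : r x <;> simp [Set.indicator, hx]
  have hEN : ∀ w, ∫ x, N w x ∂P = n * q w := by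
    intro w
    simp only [hN]
    rw [integral_finsetSum _ fun i _ => hindi (fun x => X i x = w) (hmeas i w)]
    have : ∀ i, ∫ x, (if X i x = w then (1 : ℝ) else 0) ∂P = q w := fun i => by
      rw [← hq i w]; exact hind (fun x => X i x = w) (hmeas i w)
    simp [this]
  set Cc : W → W → ℝ := fun w w' => ∫ x, N w x * N w' x ∂P with hCc
  have hCexp : ∀ w w', Cc w w' = ∑ i ∈ Finset.range n, ∑ j ∈ Finset.range n,
      P.real ({x | X i x = w} ∩ {x | X j x = w'}) := by
    intro w w'
    simp only [hCc, hN, Finset.sum_mul_sum]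
    have e : ∀ i j x, ((if X i x = w then (1 : ℝ) else 0) * if X j x = w' then (1 : ℝ) else 0) =
        if (X i x = w ∧ X j x = w') then (1 : ℝ) else 0 := by
      intro i j x
      by_cases h1 : X i x = w <;> by_cases h2 : X j x = w' <;> simp [h1, h2]
    simp_rw [e]
    rw [integral_finsetSum _ fun i _ => integrable_finsetSum _ fun j _ =>
      hindi (fun x => X i x = w ∧ X j x = w') ((hmeas i w).inter (hmeas j w'))]
    refine Finset.sum_congr rfl fun i _ => ?_
    rw [integral_finsetSum _ fun j _ => hindi (fun x => X i x = w ∧ X j x = w') ((hmeas i w).inter (hmeas j w'))]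
    exact Finset.sum_congr rfl fun j _ => hind (fun x => X i x = w ∧ X j x = w') ((hmeas i w).inter (hmeas j w'))
  have hq0 : ∀ w, 0 ≤ q w := fun w => by rw [← hq 0 w]; exact measureReal_nonneg
  have hn0 : (n : ℝ) ≠ 0 := by positivity
  have hq1 : ∑ w, q w = 1 := by
    have : ∫ x, ∑ w, N w x ∂P = n := by simp [hNsum]
    rw [integral_finsetSum _ fun w _ => hNi w] at this
    simp_rw [hEN, ← Finset.mul_sum] at this
    exact mul_left_cancel₀ hn0 (by rw [this, mul_one])
  have hC1 : ∑ w, ∑ w', Cc w w' = (n : ℝ) ^ 2 := by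
    have : ∫ x, ∑ w, ∑ w', N w x * N w' x ∂P = (n : ℝ) ^ 2 := by
      simp_rw [← Finset.sum_mul_sum, hNsum]; simp [sq]
    rw [← this, integral_finsetSum _ fun w _ => integrable_finsetSum _ fun w' _ => hNNi w w']
    refine Finset.sum_congr rfl fun w _ => ?_
    rw [integral_finsetSum _ fun w' _ => hNNi w w']
  have hC : ∀ w w', Cc w w' ≤
      (n : ℝ) ^ 2 * (q w * q w') + (n : ℝ) ^ 2 * α + if w = w' then n * q w else 0 := by
    intro w w'
    rw [hCexp]
    calc _ ≤ ∑ i ∈ Finset.range n, ∑ j ∈ Finset.range n,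
          (q w * q w' + α + if i = j then (if w = w' then q w else 0) else 0) := by
          refine Finset.sum_le_sum fun i _ => Finset.sum_le_sum fun j _ => ?_
          by_cases hij : i = j
          · subst hij
            rw [if_pos rfl]
            have h0 : 0 ≤ q w * q w' + α := add_nonneg (mul_nonneg (hq0 w) (hq0 w')) hα
            by_cases hw : w = w'
            · subst hw
              rw [if_pos rfl, Set.inter_self, hq]; linarith
            · rw [if_neg hw]
              have : {x | X i x = w} ∩ {x | X i x = w'} = ∅ := by
                ext x
                simp only [Set.mem_inter_iff, Set.mem_ofPred_eq, Set.mem_empty_iff_false, iff_false]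
                rintro ⟨rfl, h⟩
                exact hw h
              rw [this, measureReal_empty]; linarith
          · rw [if_neg hij, add_zero]
            exact hmix i j hij w w'
      _ = _ := by
          simp only [Finset.sum_add_distrib, Finset.sum_const, Finset.card_range, nsmul_eq_mul]
          have : ∑ i ∈ Finset.range n, ∑ j ∈ Finset.range n,
              (if i = j then (if w = w' then q w else 0) else 0) =
              ∑ i ∈ Finset.range n, (if w = w' then q w else 0) := by
            refine Finset.sum_congr rfl fun i hi => ?_
            rw [Finset.sum_ite_eq, if_pos hi]
          rw [this, Finset.sum_const, Finset.card_range, nsmul_eq_mul]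
          split_ifs <;> ring
  have hC0 : ∀ w w', 0 ≤ Cc w w' := fun w w' =>
    integral_nonneg fun x => mul_nonneg (hN0 w x) (hN0 w' x)
  have halg := second_moment_alg q Cc n α p (by exact_mod_cast hn) hα hq0 hq1 hp hC0 hC1 hC
  -- the product random variable
  set S : Ω × Ω → ℝ := fun z => ∑ w, N w z.1 * N w z.2 with hS
  have hSi : Integrable S (P.prod P) := integrable_finsetSum _ fun w _ => (hNi w).mul_prod (hNi w)
  have hES : ∫ z, S z ∂(P.prod P) = (n : ℝ) ^ 2 * p := by
    simp only [hS]
    rw [integral_finsetSum _ fun w _ => (hNi w).mul_prod (hNi w)]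
    simp_rw [integral_prod_mul, hEN, hp, Finset.mul_sum]
    refine Finset.sum_congr rfl fun w _ => by ring
  have hSS : ∀ z, S z ^ 2 = ∑ w, ∑ w', (N w z.1 * N w' z.1) * (N w z.2 * N w' z.2) := by
    intro z
    simp only [hS]
    rw [sq, Finset.sum_mul_sum]
    refine Finset.sum_congr rfl fun w _ => Finset.sum_congr rfl fun w' _ => by ring
  have hSSi' : ∀ w w', Integrable (fun z : Ω × Ω =>
      (N w z.1 * N w' z.1) * (N w z.2 * N w' z.2)) (P.prod P) := fun w w' =>
    (hNNi w w').mul_prod (hNNi w w')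
  have hSSi : Integrable (fun z => S z ^ 2) (P.prod P) := by
    simp_rw [hSS]
    exact integrable_finsetSum _ fun w _ => integrable_finsetSum _ fun w' _ => hSSi' w w'
  have hESS : ∫ z, S z ^ 2 ∂(P.prod P) = ∑ w, ∑ w', Cc w w' ^ 2 := by
    simp_rw [hSS]
    rw [integral_finsetSum _ fun w _ => integrable_finsetSum _ fun w' _ => hSSi' w w']
    refine Finset.sum_congr rfl fun w _ => ?_
    rw [integral_finsetSum _ fun w' _ => hSSi' w w']
    refine Finset.sum_congr rfl fun w' _ => ?_
    rw [integral_prod_mul (fun x => N w x * N w' x) (fun x => N w x * N w' x), sq]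
  set m : ℝ := (n : ℝ) ^ 2 * p with hm
  set E : Set (Ω × Ω) := {z | ∀ i < n, ∀ j < n, X i z.1 ≠ X j z.2} with hE
  have hEm : MeasurableSet E := by
    have : E = ⋂ i, ⋂ (_ : i < n), ⋂ j, ⋂ (_ : j < n), {z | X i z.1 = X j z.2}ᶜ := by
      ext z; simp [hE]
    rw [this]
    refine MeasurableSet.iInter fun i => MeasurableSet.iInter fun _ => MeasurableSet.iInter fun j =>
      MeasurableSet.iInter fun _ => MeasurableSet.compl ?_
    exact measurableSet_eq_fun ((hX i).comp measurable_fst) ((hX j).comp measurable_snd)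
  have hSE : ∀ z ∈ E, S z = 0 := by
    intro z hz
    simp only [hS, hN, Finset.sum_mul_sum]
    refine Finset.sum_eq_zero fun w _ => Finset.sum_eq_zero fun i hi =>
      Finset.sum_eq_zero fun j hj => ?_
    by_cases h1 : X i z.1 = w
    · by_cases h2 : X j z.2 = w
      · exact absurd (h1.trans h2.symm) (hz i (Finset.mem_range.1 hi) j (Finset.mem_range.1 hj))
      · simp [h2]
    · simp [h1]
  have hvar : (P.prod P).real E * m ^ 2 ≤ ∫ z, (S z ^ 2 - 2 * m * S z + m ^ 2) ∂(P.prod P) := by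
    have : (P.prod P).real E * m ^ 2 = ∫ z, E.indicator (fun _ => m ^ 2) z ∂(P.prod P) := by
      rw [integral_indicator_const _ hEm, smul_eq_mul]
    rw [this]
    apply integral_mono ((integrable_const _).indicator hEm)
    · exact (hSSi.sub (hSi.const_mul _)).add (integrable_const _)
    · intro z
      by_cases hz : z ∈ E
      · simp [Set.indicator_of_mem hz, hSE z hz]
      · simp only [Set.indicator_of_notMem hz]
        nlinarith [sq_nonneg (S z - m)]
  have hvar2 : ∫ z, (S z ^ 2 - 2 * m * S z + m ^ 2) ∂(P.prod P) = ∑ w, ∑ w', Cc w w' ^ 2 - m ^ 2 := by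
    have hd : Integrable (fun z => S z ^ 2 - 2 * m * S z) (P.prod P) :=
      hSSi.sub (hSi.const_mul _)
    rw [integral_add hd (integrable_const _),
      integral_sub hSSi (hSi.const_mul _), integral_const_mul, hES, hESS]
    simp
    ring
  have e1 : (n : ℝ) ^ 4 * p ^ 2 = m ^ 2 := by rw [hm]; ring
  rw [e1] at halg ⊢
  linarith


set_option linter.unusedSectionVars false
section Meas
variable {A : Type*} [Fintype A] [MeasurableSpace A] [MeasurableSingletonClass A]

lemma measurableSet_coord_eq (i j : ℕ) : MeasurableSet {x : ℕ → A | x i = x j} :=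
  measurableSet_eq_fun (measurable_pi_apply i) (measurable_pi_apply j)

lemma measurable_nextChange (i : ℕ) : Measurable (fun x : ℕ → A => nextChange x i) := by
  refine measurable_to_countable' fun j => ?_
  have : (fun x : ℕ → A => nextChange x i) ⁻¹' {j} =
      {x | i < j ∧ ¬ (x j = x i) ∧ ∀ t, i ≤ t → t < j → x t = x i} ∪
      {x | j = i + 1 ∧ ∀ t, i ≤ t → x t = x i} := by
    ext x
    simp only [Set.mem_preimage, Set.mem_singleton_iff, Set.mem_union, Set.mem_ofPred_eq]
    constructor
    · rintro rfl
      rcases nextChange_spec x i with h | h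
      · exact Or.inl h
      · exact Or.inr ⟨h.2, h.1⟩
    · rintro (⟨h1, h2, h3⟩ | ⟨h1, h2⟩)
      · exact nextChange_eq h1 h2 h3
      · rw [h1]; exact nextChange_const h2
  rw [this]
  refine MeasurableSet.union ?_ ?_
  · refine (MeasurableSet.const _).inter ((measurableSet_coord_eq j i).compl.inter ?_)
    refine measurableSet_setOfPred.2 ?_
    refine Measurable.forall fun t => Measurable.imp measurable_const
      (Measurable.imp measurable_const (measurableSet_setOfPred.1 (measurableSet_coord_eq t i)))
  · refine (MeasurableSet.const _).inter ?_
    refine measurableSet_setOfPred.2 ?_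
    refine Measurable.forall fun t => Measurable.imp measurable_const
      (measurableSet_setOfPred.1 (measurableSet_coord_eq t i))

lemma measurable_comp_nat {B : Type*} [MeasurableSpace B] {g : (ℕ → A) → ℕ → B}
    {r : (ℕ → A) → ℕ} (hg : ∀ i, Measurable fun x => g x i) (hr : Measurable r) :
    Measurable fun x => g x (r x) := by
  intro s hs
  have : (fun x => g x (r x)) ⁻¹' s = ⋃ i, (r ⁻¹' {i} ∩ (fun x => g x i) ⁻¹' s) := by
    ext x; simp
  rw [this]
  exact MeasurableSet.iUnion fun i => (hr (measurableSet_singleton i)).inter (hg i hs)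

lemma measurable_runStart (n : ℕ) : Measurable (fun x : ℕ → A => runStart x n) := by
  induction n with
  | zero => exact measurable_const
  | succ n ih => exact measurable_comp_nat (g := nextChange) measurable_nextChange ih

lemma measurable_rle (n : ℕ) : Measurable (fun x : ℕ → A => rle x n) := by
  refine Measurable.prodMk ?_ ?_
  · exact measurable_comp_nat (g := fun x i => x i) (fun i => measurable_pi_apply i)
      (measurable_runStart n)
  · exact (measurable_runStart (n + 1)).sub (measurable_runStart n)

/-- first k symbols -/
noncomputable def rleK (k : ℕ) (x : ℕ → A) : Fin k → A × ℕ := fun i => rle x i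

lemma measurable_rleK (k : ℕ) : Measurable (rleK (A := A) k) :=
  measurable_pi_lambda _ fun i => measurable_rle _

lemma RMatch_iff (k : ℕ) (x y : ℕ → A) : RMatch k x y ↔ rleK k x = rleK k y := by
  constructor
  · intro h; ext1 i; exact h i i.2
  · intro h m hm; exact congrFun h ⟨m, hm⟩

lemma measurableSet_RMatch (k : ℕ) :
    MeasurableSet {z : (ℕ → A) × (ℕ → A) | RMatch k z.1 z.2} := by
  simp_rw [RMatch_iff]
  exact measurableSet_eq_fun ((measurable_rleK k).comp measurable_fst)
    ((measurable_rleK k).comp measurable_snd)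

/-- collision probability as a sum -/
lemma collision_tsum {Ω W : Type*} [MeasurableSpace Ω] (P : Measure Ω) [IsProbabilityMeasure P]
    [Countable W] [MeasurableSpace W] [MeasurableSingletonClass W] (u : Ω → W) (hu : Measurable u) :
    (P.prod P).real {z | u z.1 = u z.2} = ∑' w, (P.real {x | u x = w}) ^ 2 := by
  have h1 : {z : Ω × Ω | u z.1 = u z.2} = ⋃ w, ({x | u x = w} ×ˢ {x | u x = w}) := by
    ext z; simp [eq_comm]
  have hm : ∀ w, MeasurableSet {x | u x = w} := fun w => hu (measurableSet_singleton w)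
  rw [measureReal_def, h1, measure_iUnion]
  · rw [ENNReal.tsum_toReal_eq (fun w => measure_ne_top _ _)]
    refine tsum_congr fun w => ?_
    rw [Measure.prod_prod, ENNReal.toReal_mul, sq]; rfl
  · intro w w' hw
    rw [Function.onFun, Set.disjoint_left]
    rintro z ⟨h1, -⟩ ⟨h2, -⟩
    exact hw (Eq.trans (Eq.symm h1) h2)
  · exact fun w => (hm w).prod (hm w)

lemma pushCylSum_eq (μ : Measure (ℕ → A)) [IsProbabilityMeasure μ] (k : ℕ) :
    pushCylSum μ k = (μ.prod μ).real {z | RMatch k z.1 z.2} := by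
  simp_rw [RMatch_iff]
  rw [collision_tsum μ (rleK k) (measurable_rleK k)]
  unfold pushCylSum
  refine tsum_congr fun w => ?_
  rw [measureReal_def]
  congr 4
  ext x
  simp only [Set.mem_ofPred_eq, rleK, funext_iff]

lemma pushCylSum_le_one (μ : Measure (ℕ → A)) [IsProbabilityMeasure μ] (k : ℕ) :
    pushCylSum μ k ≤ 1 := by
  rw [pushCylSum_eq]; exact measureReal_le_one

lemma pushCylSum_nonneg (μ : Measure (ℕ → A)) [IsProbabilityMeasure μ] (k : ℕ) :
    0 ≤ pushCylSum μ k := by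
  rw [pushCylSum_eq]; exact measureReal_nonneg

lemma pushCylSum_pos (μ : Measure (ℕ → A)) [IsProbabilityMeasure μ] (k : ℕ) :
    0 < pushCylSum μ k := by
  obtain ⟨w, hw⟩ : ∃ w, μ {x | rleK k x = w} ≠ 0 := by
    by_contra hcon
    push Not at hcon
    have : μ (⋃ w, {x | rleK k x = w}) = 0 := measure_iUnion_null hcon
    have h2 : (⋃ w, {x : ℕ → A | rleK k x = w}) = Set.univ := by ext x; simp
    rw [h2, measure_univ] at this
    exact one_ne_zero this
  rw [pushCylSum_eq]
  rw [measureReal_def, ENNReal.toReal_pos_iff]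
  refine ⟨?_, measure_lt_top _ _⟩
  refine lt_of_lt_of_le ?_ (measure_mono
    (show {x | rleK k x = w} ×ˢ {x | rleK k x = w} ⊆ _ from ?_))
  · rw [Measure.prod_prod]
    exact ENNReal.mul_pos hw hw
  · rintro z ⟨h1, h2⟩
    exact (RMatch_iff k _ _).2 (Eq.trans h1 (Eq.symm h2))

lemma mp_shift {μ : Measure (ℕ → A)} (hinv : MeasurePreserving (shift (A := A)) μ μ) (i : ℕ) :
    MeasurePreserving (fun (x : ℕ → A) (t : ℕ) => x (t + i)) μ μ := by
  have h := hinv.iterate i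
  have e : (shift (A := A))^[i] = fun (x : ℕ → A) (t : ℕ) => x (t + i) := by
    induction i with
    | zero => rfl
    | succ i ih =>
      rw [Function.iterate_succ, ih (hinv.iterate i)]
      funext x t
      simp only [Function.comp, shift]
      congr 1
  rwa [e] at h

lemma measure_Bad {μ : Measure (ℕ → A)} [IsProbabilityMeasure μ]
    (hinv : MeasurePreserving (shift (A := A)) μ μ) {c h : ℝ} (hA : HypA μ c h) (M L : ℕ) :
    μ.real {x | Bad M L x} ≤ (L + 1) * (Fintype.card A * (c * Real.exp (-h * M))) := by
  obtain ⟨hc, hh, hA⟩ := hA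
  have hsub : {x : ℕ → A | Bad M L x} ⊆ ⋃ i ∈ Finset.range (L + 1), ⋃ a ∈ (Finset.univ : Finset A),
      (fun (x : ℕ → A) (t : ℕ) => x (t + i)) ⁻¹' {x | ∀ t < M, x t = a} := by
    rintro x ⟨i, hi, h⟩
    simp only [Set.mem_iUnion]
    exact ⟨i, Finset.mem_range.2 (by omega), x i, Finset.mem_univ _, fun t ht => by
      rw [← h t ht]; show x (t + i) = _; rw [add_comm]⟩
  have hms : ∀ a, MeasurableSet {x : ℕ → A | ∀ t < M, x t = a} := by
    intro a
    refine measurableSet_setOfPred.2 (Measurable.forall fun t => Measurable.imp measurable_const ?_)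
    have h1 : MeasurableSet {x : ℕ → A | x t = a} :=
      (measurable_pi_apply (X := fun _ : ℕ => A) t) (measurableSet_singleton a)
    exact measurableSet_setOfPred.1 h1
  have h1 : ∀ i a, μ.real ((fun (x : ℕ → A) (t : ℕ) => x (t + i)) ⁻¹' {x | ∀ t < M, x t = a}) ≤
      c * Real.exp (-h * M) := by
    intro i a
    rw [measureReal_def, (mp_shift hinv i).measure_preimage (hms a).nullMeasurableSet]
    exact ENNReal.toReal_le_of_le_ofReal (by positivity) (hA M a)
  calc μ.real {x | Bad M L x} ≤ _ := measureReal_mono hsub (measure_ne_top _ _)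
    _ ≤ ∑ i ∈ Finset.range (L + 1), ∑ a : A, c * Real.exp (-h * M) := by
      refine (measureReal_biUnion_finset_le _ _).trans (Finset.sum_le_sum fun i _ => ?_)
      exact (measureReal_biUnion_finset_le _ _).trans (Finset.sum_le_sum fun a _ => h1 i a)
    _ = _ := by simp

lemma measure_RMatch_shift {μ : Measure (ℕ → A)} [IsProbabilityMeasure μ]
    (hinv : MeasurePreserving (shift (A := A)) μ μ) (k i j : ℕ) :
    (μ.prod μ).real {z | RMatch k (fun t => z.1 (t + i)) (fun t => z.2 (t + j))} =
      pushCylSum μ k := by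
  rw [pushCylSum_eq, measureReal_def, measureReal_def]
  have := ((mp_shift hinv i).prod (mp_shift hinv j)).measure_preimage
    (measurableSet_RMatch k).nullMeasurableSet
  rw [← this]
  rfl

lemma prod_fst {μ : Measure (ℕ → A)} [IsProbabilityMeasure μ] (s : Set (ℕ → A)) :
    (μ.prod μ).real {z | z.1 ∈ s} = μ.real s := by
  have : {z : (ℕ → A) × (ℕ → A) | z.1 ∈ s} = s ×ˢ Set.univ := by ext; simp
  rw [this, measureReal_def, Measure.prod_prod, measure_univ, mul_one]; rfl

lemma prod_snd {μ : Measure (ℕ → A)} [IsProbabilityMeasure μ] (s : Set (ℕ → A)) :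
    (μ.prod μ).real {z | z.2 ∈ s} = μ.real s := by
  have : {z : (ℕ → A) × (ℕ → A) | z.2 ∈ s} = Set.univ ×ˢ s := by ext; simp
  rw [this, measureReal_def, Measure.prod_prod, measure_univ, one_mul]; rfl

/-- upper bound on match probability -/
lemma upper_event {μ : Measure (ℕ → A)} [IsProbabilityMeasure μ]
    (hinv : MeasurePreserving (shift (A := A)) μ μ) {c h : ℝ} (hA : HypA μ c h) (k N M : ℕ) :
    (μ.prod μ).real {z | k ≤ MRLE z.1 z.2 N} ≤
      2 * (((N * M : ℕ) + 1) * (Fintype.card A * (c * Real.exp (-h * M)))) +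
        ((N * M : ℕ) + 1) ^ 2 * pushCylSum μ k := by
  set R := N * M with hR
  have hsub : {z : (ℕ → A) × (ℕ → A) | k ≤ MRLE z.1 z.2 N} ⊆
      ({z | z.1 ∈ {x | Bad M R x}} ∪ {z | z.2 ∈ {x | Bad M R x}}) ∪
      ⋃ i ∈ Finset.range (R + 1), ⋃ j ∈ Finset.range (R + 1),
        {z | RMatch k (fun t => z.1 (t + i)) (fun t => z.2 (t + j))} := by
    intro z hz
    by_cases h1 : Bad M R z.1
    · exact Or.inl (Or.inl h1)
    by_cases h2 : Bad M R z.2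
    · exact Or.inl (Or.inr h2)
    right
    obtain ⟨i, hi, j, hj, hm⟩ := exists_of_le_MRLE hz h1 h2
    simp only [Set.mem_iUnion]
    exact ⟨i, Finset.mem_range.2 (by omega), j, Finset.mem_range.2 (by omega), hm⟩
  have hB := measure_Bad hinv hA M R
  have h3 : (μ.prod μ).real (⋃ i ∈ Finset.range (R + 1), ⋃ j ∈ Finset.range (R + 1),
        {z : (ℕ → A) × (ℕ → A) | RMatch k (fun t => z.1 (t + i)) (fun t => z.2 (t + j))}) ≤
        (R + 1) ^ 2 * pushCylSum μ k := by
    calc _ ≤ ∑ i ∈ Finset.range (R + 1), ∑ j ∈ Finset.range (R + 1), pushCylSum μ k := by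
          refine (measureReal_biUnion_finset_le _ _).trans (Finset.sum_le_sum fun i _ => ?_)
          exact (measureReal_biUnion_finset_le _ _).trans
            (Finset.sum_le_sum fun j _ => (measure_RMatch_shift hinv k i j).le)
      _ = _ := by simp; ring
  have h4 := (measureReal_mono (μ := μ.prod μ) hsub).trans (measureReal_union_le _ _)
  have h5 := measureReal_union_le (μ := μ.prod μ) {z | z.1 ∈ {x | Bad M R x}} {z | z.2 ∈ {x | Bad M R x}}
  rw [prod_fst, prod_snd] at h5
  linarith

lemma tendsto_entropy {μ : Measure (ℕ → A)} [IsProbabilityMeasure μ]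
    (hex : H2lower μ = H2upper μ) (hH : 0 < H2lower μ) :
    Tendsto (fun n : ℕ => Real.log (pushCylSum μ n) / n) atTop (𝓝 (-H2lower μ)) := by
  have hle : ∀ n : ℕ, Real.log (pushCylSum μ n) / n ≤ 0 := fun n =>
    div_nonpos_of_nonpos_of_nonneg
      (Real.log_nonpos (pushCylSum_nonneg μ n) (pushCylSum_le_one μ n)) (Nat.cast_nonneg n)
  have hbA : IsBoundedUnder (· ≤ ·) atTop (fun n : ℕ => Real.log (pushCylSum μ n) / n) :=
    isBoundedUnder_of ⟨0, hle⟩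
  have hbB : IsBoundedUnder (· ≥ ·) atTop (fun n : ℕ => Real.log (pushCylSum μ n) / n) := by
    by_contra hcon
    have hempty : {a : ℝ | ∀ᶠ n : ℕ in atTop, a ≤ Real.log (pushCylSum μ n) / n} = ∅ := by
      ext a
      simp only [Set.mem_ofPred_eq, Set.mem_empty_iff_false, iff_false]
      intro ha
      exact hcon ⟨a, by simpa [Filter.eventually_map] using ha⟩
    have : H2lower μ = 0 := by
      unfold H2lower
      rw [liminf_eq, hempty, Real.sSup_empty, neg_zero]
    linarith
  refine tendsto_of_liminf_eq_limsup ?_ ?_ hbA hbB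
  · unfold H2lower; rw [neg_neg]
  · rw [hex]; unfold H2upper; rw [neg_neg]

lemma entropy_bounds {μ : Measure (ℕ → A)} [IsProbabilityMeasure μ]
    (hex : H2lower μ = H2upper μ) (hH : 0 < H2lower μ) :
    (∀ s, s < H2lower μ → ∀ᶠ k : ℕ in atTop, pushCylSum μ k ≤ Real.exp (-(s * k))) ∧
    (∀ s, H2lower μ < s → ∀ᶠ k : ℕ in atTop, Real.exp (-(s * k)) ≤ pushCylSum μ k) := by
  have ht := tendsto_entropy hex hH
  constructor
  · intro s hs
    filter_upwards [ht.eventually (gt_mem_nhds (show -H2lower μ < -s by linarith)),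
      eventually_gt_atTop 0] with k h1 hk
    rw [← Real.log_le_iff_le_exp (pushCylSum_pos μ k)]
    rw [div_lt_iff₀ (by exact_mod_cast hk)] at h1
    linarith
  · intro s hs
    filter_upwards [ht.eventually (lt_mem_nhds (show -s < -H2lower μ by linarith)),
      eventually_gt_atTop 0] with k h1 hk
    rw [← Real.le_log_iff_exp_le (pushCylSum_pos μ k)]
    rw [lt_div_iff₀ (by exact_mod_cast hk)] at h1
    linarith

end Meas


section Low
variable {A : Type*} [Fintype A] [MeasurableSpace A] [MeasurableSingletonClass A]

lemma measurable_block {W : Type*} [MeasurableSpace W] (L i : ℕ) (U : (Fin (L + 1) → A) → W) :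
    Measurable fun x : ℕ → A => U (fun s => x (s + i)) :=
  (measurable_of_countable U).comp (measurable_pi_lambda _ fun s => measurable_pi_apply _)

lemma mix_block {W : Type*} [MeasurableSpace W] [MeasurableSingletonClass W]
    {μ : Measure (ℕ → A)} {a : ℕ → ℝ} (hmix : AlphaMixingBound μ a)
    (L i g j : ℕ) (hj : i + L + g ≤ j) (U : (Fin (L + 1) → A) → W) (w w' : W) :
    μ.real ({x | U (fun s => x (s + i)) = w} ∩ {x | U (fun s => x (s + j)) = w'}) ≤
      μ.real {x | U (fun s => x (s + i)) = w} * μ.real {x | U (fun s => x (s + j)) = w'} + a g := by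
  have h := hmix (i + L) g {x | U (fun s => x (s + i)) = w} {x | U (fun s => x (s + j)) = w'} ?_ ?_
  · have := (abs_le.1 h).2
    simp only [measureReal_def]
    linarith
  · refine ⟨{v | U (fun s => v ⟨s + i, by omega⟩) = w}, Set.Finite.measurableSet (Set.toFinite _), rfl⟩
  · refine ⟨{y | U (fun s => y (s + (j - (i + L + g)))) = w'},
      measurable_block L _ U (measurableSet_singleton w'), ?_⟩
    ext x
    show U _ = w' ↔ U _ = w'
    have : ∀ s : Fin (L + 1), i + L + g + (s + (j - (i + L + g))) = s + j := fun s => by omega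
    simp only [this]

lemma lower_abstract {W : Type*} [Fintype W] [DecidableEq W] [MeasurableSpace W]
    [MeasurableSingletonClass W] {μ : Measure (ℕ → A)} [IsProbabilityMeasure μ]
    (hinv : MeasurePreserving (shift (A := A)) μ μ) {a : ℕ → ℝ} (hmix : AlphaMixingBound μ a)
    (ha : ∀ g, 0 ≤ a g)
    (L g n : ℕ) (hn : 1 ≤ n) (U : (Fin (L + 1) → A) → W) (p : ℝ)
    (hp : p = (μ.prod μ).real {z | U (fun s => z.1 s) = U (fun s => z.2 s)}) :
    (μ.prod μ).real {z | ∀ i < n, ∀ j < n,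
        U (fun s => z.1 (s + i * (L + g))) ≠ U (fun s => z.2 (s + j * (L + g)))} *
        ((n : ℝ) ^ 4 * p ^ 2) ≤
      2 * (n : ℝ) ^ 3 * (p * √p) + (n : ℝ) ^ 2 * p + 3 * (n : ℝ) ^ 4 * a g := by
  have hm0 : Measurable fun x : ℕ → A => U (fun s => x s) := measurable_block L 0 U
  have hq : ∀ i w, μ.real {x | U (fun s => x (s + i)) = w} = μ.real {x | U (fun s => x s) = w} := by
    intro i w
    have h1 : MeasurableSet {x : ℕ → A | U (fun s => x s) = w} := hm0 (measurableSet_singleton w)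
    rw [measureReal_def, measureReal_def,
      ← (mp_shift hinv i).measure_preimage h1.nullMeasurableSet]
    rfl
  refine second_moment μ n hn (fun i x => U (fun s => x (s + i * (L + g))))
    (fun i => measurable_block L _ U) (fun w => μ.real {x | U (fun s => x s) = w})
    (fun i w => hq _ w) (a g) (ha g) ?_ p ?_
  · have key : ∀ i i', i < i' → ∀ w w', μ.real ({x | U (fun s => x (s + i * (L + g))) = w} ∩
        {x | U (fun s => x (s + i' * (L + g))) = w'}) ≤
        μ.real {x | U (fun s => x s) = w} * μ.real {x | U (fun s => x s) = w'} + a g := by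
      intro i i' hii w w'
      have h1 : i * (L + g) + (L + g) ≤ i' * (L + g) := by
        rw [← Nat.succ_mul]; exact Nat.mul_le_mul_right _ hii
      have := mix_block hmix L (i * (L + g)) g (i' * (L + g)) (by omega) U w w'
      rwa [hq, hq] at this
    intro i i' hne w w'
    rcases lt_or_gt_of_ne hne with h1 | h1
    · exact key i i' h1 w w'
    · have := key i' i h1 w' w
      rw [Set.inter_comm, mul_comm (μ.real {x | U (fun s => x s) = w'})] at this
      exact this
  · rw [hp, collision_tsum μ _ hm0, tsum_fintype]

/-- extend a block by its last letter -/
def extB (L : ℕ) (v : Fin (L + 1) → A) : ℕ → A := fun t => v ⟨min t L, by omega⟩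

lemma lower_event {μ : Measure (ℕ → A)} [IsProbabilityMeasure μ]
    (hinv : MeasurePreserving (shift (A := A)) μ μ) {a : ℕ → ℝ} (hmix : AlphaMixingBound μ a)
    (ha : ∀ g, 0 ≤ a g) {c h : ℝ} (hA : HypA μ c h)
    (k M L g n N : ℕ) (hn : 1 ≤ n) (hL : k * M ≤ L) (hN : n * (L + g) + k ≤ N) :
    ∃ p e : ℝ,
      pushCylSum μ k - 2 * ((L + 1) * (Fintype.card A * (c * Real.exp (-h * M)))) ≤ p ∧
      (μ.prod μ).real {z | ¬ (k ≤ MRLE z.1 z.2 N + 1)} ≤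
        e + 2 * (((n * (L + g) + L : ℕ) + 1) * (Fintype.card A * (c * Real.exp (-h * M)))) ∧
      e * ((n : ℝ) ^ 4 * p ^ 2) ≤
        2 * (n : ℝ) ^ 3 * (p * √p) + (n : ℝ) ^ 2 * p + 3 * (n : ℝ) ^ 4 * a g := by
  classical
  let u0 : (Fin (L + 1) → A) → (Fin k → A × ℕ) := fun v => rleK k (extB L v)
  let W := Set.range u0
  let _ : Fintype W := Fintype.ofFinite _
  let U : (Fin (L + 1) → A) → W := Set.rangeFactorization u0
  have hU : ∀ v v', U v = U v' ↔ u0 v = u0 v' := by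
    intro v v'
    rw [Subtype.ext_iff]; rfl
  have hgood : ∀ x : ℕ → A, ¬ Bad M L x → u0 (fun s => x s) = rleK k x := by
    intro x hx
    ext1 m
    exact rle_congr hx hL (fun t ht => by simp [extB, min_eq_left ht]) m.2
  refine ⟨(μ.prod μ).real {z | U (fun s => z.1 s) = U (fun s => z.2 s)},
    (μ.prod μ).real {z | ∀ i < n, ∀ j < n,
        U (fun s => z.1 (s + i * (L + g))) ≠ U (fun s => z.2 (s + j * (L + g)))}, ?_, ?_,
    lower_abstract hinv hmix ha L g n hn U _ rfl⟩
  · have hB := measure_Bad hinv hA M L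
    have hsub : {z : (ℕ → A) × (ℕ → A) | RMatch k z.1 z.2} ⊆
        {z | U (fun s => z.1 s) = U (fun s => z.2 s)} ∪
        ({z | z.1 ∈ {x | Bad M L x}} ∪ {z | z.2 ∈ {x | Bad M L x}}) := by
      intro z hz
      by_cases h1 : Bad M L z.1
      · exact Or.inr (Or.inl h1)
      by_cases h2 : Bad M L z.2
      · exact Or.inr (Or.inr h2)
      left
      show U _ = U _
      rw [hU, hgood _ h1, hgood _ h2]
      exact (RMatch_iff k _ _).1 hz
    have h4 := (measureReal_mono (μ := μ.prod μ) hsub).trans (measureReal_union_le _ _)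
    have h5 := measureReal_union_le (μ := μ.prod μ) {z | z.1 ∈ {x | Bad M L x}}
      {z | z.2 ∈ {x | Bad M L x}}
    rw [prod_fst, prod_snd] at h5
    rw [← pushCylSum_eq] at h4
    linarith
  · set R := n * (L + g) + L with hR
    have hB := measure_Bad hinv hA M R
    have hsub : {z : (ℕ → A) × (ℕ → A) | ¬ (k ≤ MRLE z.1 z.2 N + 1)} ⊆
        {z | ∀ i < n, ∀ j < n,
          U (fun s => z.1 (s + i * (L + g))) ≠ U (fun s => z.2 (s + j * (L + g)))} ∪
        ({z | z.1 ∈ {x | Bad M R x}} ∪ {z | z.2 ∈ {x | Bad M R x}}) := by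
      intro z hz
      by_cases h1 : Bad M R z.1
      · exact Or.inr (Or.inl h1)
      by_cases h2 : Bad M R z.2
      · exact Or.inr (Or.inr h2)
      left
      intro i hi j hj heq
      apply hz
      have hi' : i * (L + g) ≤ n * (L + g) := Nat.mul_le_mul_right _ hi.le
      have hj' : j * (L + g) ≤ n * (L + g) := Nat.mul_le_mul_right _ hj.le
      apply le_MRLE (i := i * (L + g)) (j := j * (L + g)) (by omega) (by omega)
      rw [RMatch_iff, ← hgood _ (fun hb => h1 (hb.shift (by omega))),
        ← hgood _ (fun hb => h2 (hb.shift (by omega)))]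
      exact (hU _ _).1 heq
    have h4 := (measureReal_mono (μ := μ.prod μ) hsub).trans (measureReal_union_le _ _)
    have h5 := measureReal_union_le (μ := μ.prod μ) {z | z.1 ∈ {x | Bad M R x}}
      {z | z.2 ∈ {x | Bad M R x}}
    rw [prod_fst, prod_snd] at h5
    linarith

end Low


lemma exp_sq_small (D r h : ℝ) (hh : 0 < h) (m : ℕ) :
    ∀ᶠ k : ℕ in atTop, D * ((k : ℝ) ^ m * (Real.exp (r * k) * Real.exp (-h * (k : ℝ) ^ 2))) ≤
      Real.exp (-k) := by
  have h1 : Tendsto (fun k : ℕ => D * ((k : ℝ) ^ m * Real.exp (-(k : ℝ)))) atTop (𝓝 (D * 0)) :=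
    ((Real.tendsto_pow_mul_exp_neg_atTop_nhds_zero m).comp tendsto_natCast_atTop_atTop).const_mul D
  rw [mul_zero] at h1
  filter_upwards [h1.eventually (gt_mem_nhds one_pos),
    tendsto_natCast_atTop_atTop.eventually_ge_atTop ((r + 2) / h)] with k h2 h3
  rw [div_le_iff₀ hh] at h3
  have h4 : Real.exp (r * k) * Real.exp (-h * (k : ℝ) ^ 2) ≤ Real.exp (-k) * Real.exp (-k) := by
    rw [← Real.exp_add, ← Real.exp_add, Real.exp_le_exp]
    nlinarith [Nat.cast_nonneg (α := ℝ) k]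
  rcases le_or_gt D 0 with hD | hD
  · have : D * ((k : ℝ) ^ m * (Real.exp (r * k) * Real.exp (-h * (k : ℝ) ^ 2))) ≤ 0 :=
      mul_nonpos_of_nonpos_of_nonneg hD (by positivity)
    linarith [Real.exp_pos (-(k : ℝ))]
  · calc D * ((k : ℝ) ^ m * (Real.exp (r * k) * Real.exp (-h * (k : ℝ) ^ 2)))
        ≤ D * ((k : ℝ) ^ m * (Real.exp (-k) * Real.exp (-k))) := by gcongr
      _ = (D * ((k : ℝ) ^ m * Real.exp (-(k : ℝ)))) * Real.exp (-k) := by ring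
      _ ≤ 1 * Real.exp (-k) := by gcongr
      _ = _ := one_mul _

lemma summable_pe (D d : ℝ) (hd : 0 < d) (m : ℕ) :
    Summable fun k : ℕ => D * ((k : ℝ) ^ m * Real.exp (-(d * k))) := by
  have := (Real.summable_pow_mul_exp_neg_nat_mul m hd).mul_left D
  refine this.congr fun k => ?_
  congr 3; ring

section Final
variable {A : Type*} [Fintype A] [MeasurableSpace A] [MeasurableSingletonClass A]

lemma upper_ae {μ : Measure (ℕ → A)} [IsProbabilityMeasure μ]
    (hinv : MeasurePreserving (shift (A := A)) μ μ) {c h : ℝ} (hA : HypA μ c h)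
    (hex : H2lower μ = H2upper μ) (hH : 0 < H2lower μ) (q : ℝ) (hq0 : 0 < q)
    (hq : q < H2lower μ / 2) :
    ∀ᵐ z ∂(μ.prod μ), ∀ᶠ k : ℕ in atTop, MRLE z.1 z.2 ⌊Real.exp (k * q)⌋₊ < k := by
  obtain ⟨s, hs1, hs2⟩ := exists_between (show 2 * q < H2lower μ by linarith)
  have hd : 0 < s - 2 * q := by linarith
  have hc := hA.1
  have hh := hA.2.1
  have key := ae_eventually_of_summable (μ.prod μ)
    (fun k : ℕ => {z | k ≤ MRLE z.1 z.2 ⌊Real.exp (k * q)⌋₊})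
    (fun k => 1 * ((k : ℝ) ^ 0 * Real.exp (-(1 * k))) +
      4 * ((k : ℝ) ^ 4 * Real.exp (-((s - 2 * q) * k))))
    ((summable_pe 1 1 one_pos 0).add (summable_pe 4 _ hd 4)) ?_
  · filter_upwards [key] with z hz
    filter_upwards [hz] with k hk
    simpa using hk
  · filter_upwards [(entropy_bounds hex hH).1 s hs2,
      exp_sq_small (4 * (Fintype.card A * c)) q h hh 2, eventually_ge_atTop 1] with k h1 h2 hk
    have h3 := upper_event hinv hA k ⌊Real.exp (k * q)⌋₊ (k ^ 2)
    have hk1 : (1 : ℝ) ≤ k := by exact_mod_cast hk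
    have hE1 : (1 : ℝ) ≤ Real.exp (k * q) := Real.one_le_exp (by positivity)
    have hR : (((⌊Real.exp (k * q)⌋₊ * k ^ 2 : ℕ) : ℝ) + 1) ≤ 2 * ((k : ℝ) ^ 2 * Real.exp (q * k)) := by
      push_cast
      have h4 : (⌊Real.exp (k * q)⌋₊ : ℝ) ≤ Real.exp (k * q) := Nat.floor_le (Real.exp_pos _).le
      have h5 : (⌊Real.exp (k * q)⌋₊ : ℝ) * (k : ℝ) ^ 2 ≤ Real.exp (k * q) * (k : ℝ) ^ 2 := by gcongr
      have h6 : 1 ≤ Real.exp (k * q) * (k : ℝ) ^ 2 :=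
        one_le_mul_of_one_le_of_one_le hE1 (one_le_pow₀ hk1)
      rw [mul_comm q]; linarith
    set R := (((⌊Real.exp (k * q)⌋₊ * k ^ 2 : ℕ) : ℝ) + 1) with hRdef
    have hR0 : 0 ≤ R := by positivity
    have hp0 := pushCylSum_nonneg μ k
    refine h3.trans (add_le_add ?_ ?_)
    · rw [Nat.cast_pow]
      calc 2 * (R * (Fintype.card A * (c * Real.exp (-h * (k : ℝ) ^ 2))))
          ≤ 2 * (2 * ((k : ℝ) ^ 2 * Real.exp (q * k)) *
            (Fintype.card A * (c * Real.exp (-h * (k : ℝ) ^ 2)))) := by gcongr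
        _ = 4 * (Fintype.card A * c) *
            ((k : ℝ) ^ 2 * (Real.exp (q * k) * Real.exp (-h * (k : ℝ) ^ 2))) := by ring
        _ ≤ _ := h2
        _ = _ := by simp
    · calc R ^ 2 * pushCylSum μ k
          ≤ (2 * ((k : ℝ) ^ 2 * Real.exp (q * k))) ^ 2 * Real.exp (-(s * k)) := by gcongr
        _ = 4 * ((k : ℝ) ^ 4 * (Real.exp (q * k) * Real.exp (q * k) * Real.exp (-(s * k)))) := by ring
        _ = _ := by
          rw [← Real.exp_add, ← Real.exp_add]; ring_nf

lemma sm_bound {n p e α r t : ℝ} (hn : 0 < n) (hα : 0 ≤ α) (hr : 0 < r) (hrp : r ≤ p)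
    (ht : 0 < t) (htn : t ^ 2 ≤ n ^ 2 * r)
    (he : e * (n ^ 4 * p ^ 2) ≤ 2 * n ^ 3 * (p * √p) + n ^ 2 * p + 3 * n ^ 4 * α) :
    e ≤ 2 / t + 1 / t ^ 2 + 3 * (α / r ^ 2) := by
  have hp : 0 < p := hr.trans_le hrp
  have hs : 0 < √p := Real.sqrt_pos.2 hp
  have hsq : √p ^ 2 = p := Real.sq_sqrt hp.le
  have h1 : t ≤ n * √p := by
    apply le_of_sq_le_sq _ (by positivity)
    rw [mul_pow, hsq]
    exact htn.trans (by gcongr)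
  have h2 : e ≤ 2 / (n * √p) + 1 / (n * √p) ^ 2 + 3 * (α / p ^ 2) := by
    have h3 : e ≤ (2 * n ^ 3 * (p * √p) + n ^ 2 * p + 3 * n ^ 4 * α) / (n ^ 4 * p ^ 2) := by
      rw [le_div_iff₀ (by positivity)]; exact he
    refine h3.trans (le_of_eq ?_)
    rw [mul_pow, hsq]
    have : 2 / (n * √p) = 2 * √p / (n * p) := by
      rw [div_eq_div_iff (by positivity) (by positivity)]
      linear_combination (-2 * n) * hsq
    rw [this]
    field_simp
  refine h2.trans ?_
  gcongr

lemma lower_ae {μ : Measure (ℕ → A)} [IsProbabilityMeasure μ]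
    (hinv : MeasurePreserving (shift (A := A)) μ μ) {c h : ℝ} (hA : HypA μ c h)
    (hmix : AlphaMixingExp μ)
    (hex : H2lower μ = H2upper μ) (hH : 0 < H2lower μ) (q : ℝ)
    (hq : H2lower μ / 2 < q) :
    ∀ᵐ z ∂(μ.prod μ), ∀ᶠ k : ℕ in atTop, k ≤ MRLE z.1 z.2 ⌊Real.exp (k * q)⌋₊ + 1 := by
  obtain ⟨b, hb1, hbq⟩ := exists_between hq
  obtain ⟨s, hs1, hs2⟩ := exists_between (show H2lower μ < 2 * b by linarith)
  obtain ⟨C, θ, hC, hθ, hmix⟩ := hmix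
  have hb : 0 < b := by linarith
  have hd : 0 < (2 * b - s) / 2 := by linarith
  have hc := hA.1
  have hh := hA.2.1
  have key := ae_eventually_of_summable (μ.prod μ)
    (fun k : ℕ => {z | ¬ (k ≤ MRLE z.1 z.2 ⌊Real.exp (k * q)⌋₊ + 1)})
    (fun k => 6 * ((k : ℝ) ^ 0 * Real.exp (-((2 * b - s) / 2 * k))) +
      9 * ((k : ℝ) ^ 0 * Real.exp (-((2 * b - s) * k))) +
      2 * ((k : ℝ) ^ 0 * Real.exp (-(1 * k))))
    (((summable_pe 6 _ hd 0).add (summable_pe 9 _ (by linarith) 0)).add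
      (summable_pe 2 _ one_pos 0)) ?_
  · filter_upwards [key] with z hz
    filter_upwards [hz] with k hk
    simpa using hk
  · have hbq' : 0 < q - b := by linarith
    have hgrow : ∀ᶠ k : ℕ in atTop, 4 * ((k : ℝ) ^ 3 * Real.exp (-((q - b) * k))) < 1 := by
      have := (summable_pe 4 (q - b) hbq' 3).tendsto_atTop_zero
      exact this.eventually (gt_mem_nhds one_pos)
    filter_upwards [(entropy_bounds hex hH).2 s hs1, hgrow,
      exp_sq_small (8 * (Fintype.card A * c)) s h hh 3,
      exp_sq_small (10 * (Fintype.card A * c)) b h hh 3,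
      exp_sq_small (12 * C) (2 * s) θ hθ 0, eventually_ge_atTop 2] with k h1 h2 h3 h4 h5 hk
    have hk1 : (2 : ℝ) ≤ k := by exact_mod_cast hk
    have hk3 : (1 : ℝ) ≤ (k : ℝ) ^ 3 := one_le_pow₀ (by linarith)
    have hk23 : (k : ℝ) ^ 2 ≤ (k : ℝ) ^ 3 := pow_le_pow_right₀ (by linarith) (by norm_num)
    have hk13 : (k : ℝ) ≤ (k : ℝ) ^ 3 := le_self_pow₀ (by linarith) (by norm_num)
    have hE1 : (1 : ℝ) ≤ Real.exp (b * k) := Real.one_le_exp (by positivity)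
    set n : ℕ := ⌊Real.exp (b * k)⌋₊ with hn
    have hn1 : 1 ≤ n := Nat.le_floor (by simpa using hE1)
    have hnle : (n : ℝ) ≤ Real.exp (b * k) := Nat.floor_le (Real.exp_pos _).le
    have hnge : Real.exp (b * k) ≤ 2 * n := by
      have := Nat.lt_floor_add_one (Real.exp (b * k))
      have h1' : (1 : ℝ) ≤ n := by exact_mod_cast hn1
      rw [← hn] at this
      linarith
    have hN : n * (k ^ 3 + k ^ 2) + k ≤ ⌊Real.exp (k * q)⌋₊ := by
      apply Nat.le_floor
      push_cast
      have e1 : 4 * (k : ℝ) ^ 3 * Real.exp (b * k) ≤ Real.exp (k * q) := by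
        have : Real.exp (k * q) = Real.exp (b * k) * Real.exp ((q - b) * k) := by
          rw [← Real.exp_add]; ring_nf
        rw [this]
        rw [Real.exp_neg] at h2
        have hpos := Real.exp_pos ((q - b) * k)
        have e2 : 4 * (k : ℝ) ^ 3 ≤ Real.exp ((q - b) * k) := by
          rw [← mul_assoc, ← div_eq_mul_inv, div_lt_one hpos] at h2
          exact h2.le
        rw [mul_comm]; gcongr
      have e3 : (n : ℝ) * ((k : ℝ) ^ 3 + (k : ℝ) ^ 2) ≤ Real.exp (b * k) * (2 * (k : ℝ) ^ 3) := by
        gcongr; linarith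
      have e4 : (k : ℝ) ≤ Real.exp (b * k) * (k : ℝ) ^ 3 := by nlinarith
      have e5 : 0 ≤ Real.exp (b * k) * (k : ℝ) ^ 3 := by positivity
      linarith
    obtain ⟨p, e, hp, he, hm⟩ := lower_event hinv hmix (fun g => by positivity) hA k (k ^ 2) (k ^ 3)
      (k ^ 2) n _ hn1 (by rw [← pow_succ']) hN
    have hbad : 2 * (((n * (k ^ 3 + k ^ 2) + k ^ 3 : ℕ) + 1) *
        (Fintype.card A * (c * Real.exp (-h * ((k ^ 2 : ℕ) : ℝ))))) ≤ Real.exp (-k) := by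
      push_cast
      have e3 : (n : ℝ) * ((k : ℝ) ^ 3 + (k : ℝ) ^ 2) ≤ Real.exp (b * k) * (2 * (k : ℝ) ^ 3) := by
        gcongr; linarith
      have e4 : (k : ℝ) ^ 3 ≤ Real.exp (b * k) * (k : ℝ) ^ 3 := le_mul_of_one_le_left (by positivity) hE1
      have e5 : 1 ≤ Real.exp (b * k) * (k : ℝ) ^ 3 := hk3.trans e4
      have e6 : (n : ℝ) * ((k : ℝ) ^ 3 + (k : ℝ) ^ 2) + (k : ℝ) ^ 3 + 1 ≤
          5 * (Real.exp (b * k) * (k : ℝ) ^ 3) := by linarith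
      calc 2 * (((n : ℝ) * ((k : ℝ) ^ 3 + (k : ℝ) ^ 2) + (k : ℝ) ^ 3 + 1) *
            (Fintype.card A * (c * Real.exp (-h * (k : ℝ) ^ 2))))
          ≤ 2 * (5 * (Real.exp (b * k) * (k : ℝ) ^ 3) *
            (Fintype.card A * (c * Real.exp (-h * (k : ℝ) ^ 2)))) := by gcongr
        _ = 10 * (Fintype.card A * c) *
            ((k : ℝ) ^ 3 * (Real.exp (b * k) * Real.exp (-h * (k : ℝ) ^ 2))) := by ring
        _ ≤ _ := h4
    have hsm : e ≤ 6 * ((k : ℝ) ^ 0 * Real.exp (-((2 * b - s) / 2 * k))) +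
        9 * ((k : ℝ) ^ 0 * Real.exp (-((2 * b - s) * k))) + Real.exp (-k) := by
      have hrp : Real.exp (-(s * k)) / 2 ≤ p := by
        have e1 : 2 * ((((k ^ 3 : ℕ) : ℝ) + 1) *
            (Fintype.card A * (c * Real.exp (-h * ((k ^ 2 : ℕ) : ℝ))))) ≤
            Real.exp (-(s * k)) / 2 := by
          push_cast
          have e2 : 8 * (Fintype.card A * c) * ((k : ℝ) ^ 3 * Real.exp (-h * (k : ℝ) ^ 2)) ≤
              Real.exp (-(s * k)) := by
            have e3 : 8 * (Fintype.card A * c) * ((k : ℝ) ^ 3 *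
                (Real.exp (s * k) * Real.exp (-h * (k : ℝ) ^ 2))) ≤ 1 :=
              h3.trans (Real.exp_le_one_iff.2 (by linarith))
            rw [Real.exp_neg (s * k), ← one_div, le_div_iff₀ (Real.exp_pos _)]
            refine le_trans (le_of_eq ?_) e3
            ring
          have e4 : 2 * (((k : ℝ) ^ 3 + 1) * (Fintype.card A * (c * Real.exp (-h * (k : ℝ) ^ 2)))) ≤
              2 * ((2 * (k : ℝ) ^ 3) * (Fintype.card A * (c * Real.exp (-h * (k : ℝ) ^ 2)))) := by
            gcongr; linarith
          linarith
        linarith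
      have hb' := sm_bound (n := n) (p := p) (e := e) (α := C * Real.exp (-θ * ((k ^ 2 : ℕ) : ℝ)))
        (r := Real.exp (-(s * k)) / 2) (t := Real.exp ((2 * b - s) / 2 * k) / 3)
        (by positivity) (by positivity) (by positivity) hrp (by positivity) ?_ hm
      · refine hb'.trans ?_
        have t1 : 2 / (Real.exp ((2 * b - s) / 2 * k) / 3) =
            6 * ((k : ℝ) ^ 0 * Real.exp (-((2 * b - s) / 2 * k))) := by
          rw [Real.exp_neg]; field_simp; norm_num
        have t2 : 1 / (Real.exp ((2 * b - s) / 2 * k) / 3) ^ 2 =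
            9 * ((k : ℝ) ^ 0 * Real.exp (-((2 * b - s) * k))) := by
          have : Real.exp (-((2 * b - s) * k)) = (Real.exp ((2 * b - s) / 2 * k) ^ 2)⁻¹ := by
            rw [← Real.exp_nat_mul, ← Real.exp_neg]; push_cast; ring_nf
          rw [this]; field_simp; norm_num
        have t3 : 3 * (C * Real.exp (-θ * ((k ^ 2 : ℕ) : ℝ)) / (Real.exp (-(s * k)) / 2) ^ 2) ≤
            Real.exp (-k) := by
          refine le_trans (le_of_eq ?_) h5
          have : Real.exp (2 * s * k) = (Real.exp (-(s * k)) ^ 2)⁻¹ := by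
            rw [← Real.exp_nat_mul, ← Real.exp_neg]; push_cast; ring_nf
          rw [this]; push_cast; field_simp; norm_num
        rw [t1, t2]
        linarith
      · have e1 : (Real.exp ((2 * b - s) / 2 * k) / 3) ^ 2 =
            Real.exp (b * k) ^ 2 * Real.exp (-(s * k)) / 9 := by
          rw [div_pow, ← Real.exp_nat_mul, ← Real.exp_nat_mul, ← Real.exp_add]
          norm_num
          ring_nf
        rw [e1]
        have e2 : Real.exp (b * k) ^ 2 ≤ (2 * (n : ℝ)) ^ 2 := by gcongr
        have e3 := Real.exp_pos (-(s * k))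
        have e4 : Real.exp (b * k) ^ 2 * Real.exp (-(s * k)) ≤
          (2 * (n : ℝ)) ^ 2 * Real.exp (-(s * k)) := by gcongr
        have e5 : 0 ≤ (n : ℝ) ^ 2 * Real.exp (-(s * k)) := by positivity
        linarith
    have e1 : (2 : ℝ) * ((k : ℝ) ^ 0 * Real.exp (-(1 * k))) = Real.exp (-k) + Real.exp (-k) := by
      rw [pow_zero, one_mul, one_mul, two_mul]
    rw [e1]
    linarith

end Final


/-- Theorem `thprinc`, limit form: if hypothesis (A) holds, the process is
α-mixing with exponential decay, and the Rényi entropy of order 2 of `f_*μ` exists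
(lower = upper) and is strictly positive, then for `μ ⊗ μ`-a.e. `(x, y)`,
`lim_n M^RLE_n(x,y)/log n = 2/H₂(f_*μ)`. -/
theorem stmt2 {A : Type*} [Fintype A] [MeasurableSpace A] [MeasurableSingletonClass A]
    (μ : Measure (ℕ → A)) [IsProbabilityMeasure μ]
    (hinv : MeasurePreserving (shift (A := A)) μ μ)
    (c h : ℝ) (hA : HypA μ c h)
    (hmix : AlphaMixingExp μ)
    (hex : H2lower μ = H2upper μ) (hH : 0 < H2lower μ) :
    ∀ᵐ p ∂(μ.prod μ),
      Tendsto (fun n : ℕ => (MRLE p.1 p.2 n : ℝ) / Real.log n) atTop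
        (𝓝 (2 / H2lower μ)) := by
  have hU : ∀ᵐ z ∂(μ.prod μ), ∀ q : ℚ, 0 < (q:ℝ) → (q:ℝ) < H2lower μ / 2 →
      ∀ᶠ k : ℕ in atTop, MRLE z.1 z.2 ⌊Real.exp (k * (q:ℝ))⌋₊ < k := by
    rw [ae_all_iff]
    intro q
    by_cases h1 : 0 < (q:ℝ)
    · by_cases h2 : (q:ℝ) < H2lower μ / 2
      · filter_upwards [upper_ae hinv hA hex hH q h1 h2] with z hz _ _ using hz
      · exact Eventually.of_forall fun z _ h => absurd h h2
    · exact Eventually.of_forall fun z h => absurd h h1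
  have hL : ∀ᵐ z ∂(μ.prod μ), ∀ q : ℚ, H2lower μ / 2 < (q:ℝ) →
      ∀ᶠ k : ℕ in atTop, k ≤ MRLE z.1 z.2 ⌊Real.exp (k * (q:ℝ))⌋₊ + 1 := by
    rw [ae_all_iff]
    intro q
    by_cases h2 : H2lower μ / 2 < (q:ℝ)
    · filter_upwards [lower_ae hinv hA hmix hex hH q h2] with z hz _ using hz
    · exact Eventually.of_forall fun z h => absurd h h2
  filter_upwards [hU, hL] with z h1 h2
  have := tendsto_of_interp (MRLE z.1 z.2) (MRLE_mono _ _) (H2lower μ / 2) (by linarith) h1 h2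
  rwa [one_div_div] at this
end

section
/- For every pair of sequences x, y in A^ℕ and every n ∈ ℕ, M^RLE_n(x,y) ≥ M̃_n(x,y) − 1. -/
open MeasureTheory Filter Topology

theorem aux_shift {A : Type*} (x : ℕ → A) (i t : ℕ) :
    nextChange (fun t => x (t + i)) t + i = nextChange x (t + i) := by
  classical
  have e : ∀ j, t + j + 1 + i = t + i + j + 1 := fun j => by omega
  unfold nextChange
  simp only [e]
  split_ifs <;> omega

theorem aux_lt {A : Type*} (x : ℕ → A) (i : ℕ) : i < nextChange x i := by
  unfold nextChange
  split_ifs <;> omega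

theorem aux_mid {A : Type*} (x : ℕ → A) (s i : ℕ) (h1 : s ≤ i) (h2 : i < nextChange x s) :
    nextChange x s = nextChange x i := by
  classical
  by_cases hs : ∃ j, x (s + j + 1) ≠ x s
  · have e1 : nextChange x s = s + Nat.find hs + 1 := by
      unfold nextChange
      rw [dif_pos hs]
    have hc : ∀ t, s ≤ t → t < nextChange x s → x t = x s := by
      intro t h3 h4
      rcases Nat.eq_or_lt_of_le h3 with h | h
      · rw [h]
      · have := Nat.find_min hs (m := t - s - 1) (by omega)
        rw [not_not] at this
        rwa [show s + (t - s - 1) + 1 = t by omega] at this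
    have hn := Nat.find_spec hs
    rw [← e1] at hn
    have hi : ∃ j, x (i + j + 1) ≠ x i := by
      refine ⟨nextChange x s - i - 1, ?_⟩
      rw [show i + (nextChange x s - i - 1) + 1 = nextChange x s by omega, hc i h1 h2]
      exact hn
    have e2 : nextChange x i = i + Nat.find hi + 1 := by
      unfold nextChange
      rw [dif_pos hi]
    have h5 : Nat.find hi = nextChange x s - i - 1 := by
      rw [Nat.find_eq_iff]
      constructor
      · rw [show i + (nextChange x s - i - 1) + 1 = nextChange x s by omega, hc i h1 h2]
        exact hn
      · intro m hm
        rw [not_not, hc i h1 h2]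
        exact hc _ (by omega) (by omega)
    omega
  · have e1 : nextChange x s = s + 1 := by
      unfold nextChange
      rw [dif_neg hs]
    have : s = i := by omega
    rw [this]

theorem aux_loc {A : Type*} (x : ℕ → A) (i : ℕ) :
    ∃ p, p ≤ i ∧ runStart x p ≤ i ∧ i < runStart x (p + 1) := by
  induction i with
  | zero => exact ⟨0, le_refl _, le_refl _, aux_lt x 0⟩
  | succ i ih =>
    obtain ⟨p, h0, h1, h2⟩ := ih
    by_cases h : i + 1 < runStart x (p + 1)
    · exact ⟨p, by omega, by omega, h⟩
    · have h3 := aux_lt x (runStart x (p + 1))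
      refine ⟨p + 1, by omega, by omega, ?_⟩
      change i + 1 < nextChange x (runStart x (p + 1))
      omega

theorem aux_run {A : Type*} (x : ℕ → A) (i : ℕ) :
    ∃ p, p ≤ i ∧ ∀ m, runStart (fun t => x (t + i)) (m + 1) + i = runStart x (p + 1 + m) := by
  obtain ⟨p, h0, h1, h2⟩ := aux_loc x i
  refine ⟨p, h0, fun m => ?_⟩
  induction m with
  | zero =>
    change nextChange (fun t => x (t + i)) 0 + i = nextChange x (runStart x p)
    rw [aux_shift, aux_mid x _ i h1 h2, Nat.zero_add]
  | succ m ih =>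
    change nextChange (fun t => x (t + i)) (runStart (fun t => x (t + i)) (m + 1)) + i
      = nextChange x (runStart x (p + 1 + m))
    rw [aux_shift, ih]

theorem aux_rle {A : Type*} (x : ℕ → A) (i : ℕ) :
    ∃ p, p ≤ i ∧ ∀ m, rle (fun t => x (t + i)) (m + 1) = rle x (p + 1 + m) := by
  obtain ⟨p, h0, h⟩ := aux_run x i
  refine ⟨p, h0, fun m => ?_⟩
  have a := h m
  have b := h (m + 1)
  unfold rle
  refine Prod.ext ?_ ?_
  · change x (_ + i) = _
    rw [a]
  · change runStart (fun t => x (t + i)) (m + 1 + 1) - runStart (fun t => x (t + i)) (m + 1)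
      = runStart x (p + 1 + (m + 1)) - runStart x (p + 1 + m)
    omega

/-- for every `x, y ∈ A^ℕ` and every `n`, `M^RLE_n(x,y) ≥ M̃_n(x,y) - 1`. -/
theorem stmt4 {A : Type*} (x y : ℕ → A) (n : ℕ) :
    Mtilde x y n - 1 ≤ MRLE x y n := by
  have hb : BddAbove {k | ∃ i j, i + k ≤ n ∧ j + k ≤ n ∧
      ∀ m < k, rle x (i + m) = rle y (j + m)} :=
    ⟨n, by rintro k ⟨i, j, h, -, -⟩; omega⟩
  have hm : Mtilde x y n ∈ {k | ∃ i j, i + k ≤ n ∧ j + k ≤ n ∧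
      ∀ m < k, rle (fun t => x (t + i)) m = rle (fun t => y (t + j)) m} := by
    apply Nat.sSup_mem
    · exact ⟨0, 0, 0, by omega, by omega, fun m hm => by omega⟩
    · exact ⟨n, by rintro k ⟨i, j, h, -, -⟩; omega⟩
  obtain ⟨i, j, hi, hj, h⟩ := hm
  obtain hz | hz := Nat.eq_zero_or_pos (Mtilde x y n)
  · omega
  obtain ⟨p, hp, hx⟩ := aux_rle x i
  obtain ⟨q, hq, hy⟩ := aux_rle y j
  refine le_csSup hb ⟨p + 1, q + 1, by omega, by omega, fun m hm => ?_⟩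
  rw [← hx, ← hy]
  exact h _ (by omega)
end
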